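/- arXiv:1207.3500 — 2 statements merged into one kernel-verified Lean document; each statement's English description precedes it below -/
import Mathlib

section
/- Let A and V be bounded self-adjoint operators on a separable infinite-dimensional complex Hilbert space H with V in the Schatten 3-class B_3(H), and let r ≥ 0 be an integer. Set A_τ = A + τV for 0 ≤ τ ≤ 1. Then (A+V)^r − A^r − D^{(1)}(A^r)(V) − (1/2) D^{(2)}(A^r)(V,V) is trace class and Tr[(A+V)^r − A^r − D^{(1)}(A^r)(V) − (1/2) D^{(2)}(A^r)(V,V)] = r ∑_{k=0}^{r-2} ∫_0^1 ds ∫_0^s dτ Tr[V A_τ^{r-k-2} V A_τ^{k} − V A^{r-k-2} V A^{k}]. -/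
open MeasureTheory
noncomputable section

local notation "⟪" x ", " y "⟫" => @inner ℂ _ _ x y

variable {H : Type} [NormedAddCommGroup H] [InnerProductSpace ℂ H] [CompleteSpace H]

/-- The trace of an operator, computed along a Hilbert basis indexed by `ℕ`
(for a trace-class operator this is the usual trace). -/
def traceAlong (e : HilbertBasis ℕ ℂ H) (T : H →L[ℂ] H) : ℂ :=
  ∑' n, ⟪e n, T (e n)⟫

/-- The absolute value `|T| = (T^* T)^{1/2}` of a bounded operator. -/
def absCLM (T : H →L[ℂ] H) : H →L[ℂ] H := CFC.sqrt (star T * T)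

/-- `T` is trace class: `Tr |T| < ∞`. -/
def IsTraceClass (e : HilbertBasis ℕ ℂ H) (T : H →L[ℂ] H) : Prop :=
  Summable fun n => (⟪e n, absCLM T (e n)⟫).re

/-- `T` belongs to the Schatten 3-class: `Tr |T|³ < ∞`. -/
def IsSchatten3 (e : HilbertBasis ℕ ℂ H) (T : H →L[ℂ] H) : Prop :=
  Summable fun n => (⟪e n, (absCLM T ^ 3) (e n)⟫).re

/-- First Fréchet derivative of `X ↦ X^r` at `A`, evaluated at `V`:
`D¹(A^r)(V) = ∑_{j=0}^{r-1} A^{r-j-1} V A^j`. -/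
def D1pow (A V : H →L[ℂ] H) (r : ℕ) : H →L[ℂ] H :=
  ∑ j ∈ Finset.range r, A ^ (r - 1 - j) * V * A ^ j

/-- Second Fréchet derivative of `X ↦ X^r` at `A`, evaluated at `(X,Y)`:
`D²(A^r)(X,Y) = ∑_{j=0}^{r-2} ∑_{k=0}^{r-j-2} A^{r-j-k-2} X A^k Y A^j
               + ∑_{j=1}^{r-1} ∑_{k=0}^{j-1} A^{r-j-1} Y A^k X A^{j-k-1}`. -/
def D2pow (A X Y : H →L[ℂ] H) (r : ℕ) : H →L[ℂ] H :=
  (∑ j ∈ Finset.range (r - 1), ∑ k ∈ Finset.range (r - 1 - j),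
      A ^ (r - 2 - j - k) * X * A ^ k * Y * A ^ j)
    + ∑ j ∈ Finset.Icc 1 (r - 1), ∑ k ∈ Finset.range j,
      A ^ (r - 1 - j) * Y * A ^ k * X * A ^ (j - 1 - k)

open InnerProductSpace (rankOne)

/-- `T` is nuclear: an absolutely convergent sum of operators of rank at most one. -/
def IsNuclear (T : H →L[ℂ] H) : Prop :=
  ∃ (ι : Type) (x y : ι → H), Summable (fun i => ‖x i‖ * ‖y i‖) ∧
    HasSum (fun i => rankOne ℂ (x i) (y i)) T

namespace IsNuclear

theorem zero : IsNuclear (0 : H →L[ℂ] H) :=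
  ⟨Empty, fun _ => 0, fun _ => 0, by simp, by simp⟩

theorem add {S T : H →L[ℂ] H} (hS : IsNuclear S) (hT : IsNuclear T) : IsNuclear (S + T) := by
  obtain ⟨ι, x, y, h, hs⟩ := hS
  obtain ⟨κ, z, w, h', hs'⟩ := hT
  refine ⟨ι ⊕ κ, Sum.elim x z, Sum.elim y w, ?_, ?_⟩
  · exact (HasSum.sum (f := fun i => ‖Sum.elim x z i‖ * ‖Sum.elim y w i‖)
      (by simpa [Function.comp_def] using h.hasSum)
      (by simpa [Function.comp_def] using h'.hasSum)).summable
  · exact HasSum.sum (f := fun i => rankOne ℂ (Sum.elim x z i) (Sum.elim y w i))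
      (by simpa [Function.comp_def] using hs) (by simpa [Function.comp_def] using hs')

theorem mul_left {T : H →L[ℂ] H} (hT : IsNuclear T) (B : H →L[ℂ] H) : IsNuclear (B * T) := by
  obtain ⟨ι, x, y, h, hs⟩ := hT
  refine ⟨ι, fun i => B (x i), y, ?_, ?_⟩
  · refine Summable.of_nonneg_of_le (fun i => by positivity) (fun i => ?_) (h.mul_left ‖B‖)
    rw [← mul_assoc]
    gcongr
    exact B.le_opNorm _
  · simp only [← InnerProductSpace.comp_rankOne]
    exact hs.mul_left B

theorem mul_right {T : H →L[ℂ] H} (hT : IsNuclear T) (B : H →L[ℂ] H) : IsNuclear (T * B) := by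
  obtain ⟨ι, x, y, h, hs⟩ := hT
  refine ⟨ι, x, fun i => star B (y i), ?_, ?_⟩
  · refine Summable.of_nonneg_of_le (fun i => by positivity) (fun i => ?_) (h.mul_left ‖star B‖)
    calc ‖x i‖ * ‖star B (y i)‖ ≤ ‖x i‖ * (‖star B‖ * ‖y i‖) := by
          gcongr
          exact (star B).le_opNorm _
      _ = ‖star B‖ * (‖x i‖ * ‖y i‖) := by ring
  · simp only [ContinuousLinearMap.star_eq_adjoint, ← InnerProductSpace.rankOne_comp]
    exact hs.mul_right B

theorem smul {T : H →L[ℂ] H} (hT : IsNuclear T) (c : ℂ) : IsNuclear (c • T) := by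
  simpa using hT.mul_left (c • 1)

theorem sum {α : Type*} (s : Finset α) {T : α → H →L[ℂ] H} (hT : ∀ a ∈ s, IsNuclear (T a)) :
    IsNuclear (∑ a ∈ s, T a) :=
  Finset.sum_induction _ _ (fun _ _ => add) zero hT

theorem isCompactOperator {T : H →L[ℂ] H} (hT : IsNuclear T) : IsCompactOperator T := by
  obtain ⟨ι, x, y, -, hs⟩ := hT
  have hcl : IsClosed {S : H →L[ℂ] H | IsCompactOperator S} :=
    isClosed_setOfPred_isCompactOperator
  refine hcl.mem_of_tendsto hs (Filter.Eventually.of_forall fun s => ?_)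
  refine Finset.sum_induction _ (fun S : H →L[ℂ] H => IsCompactOperator S)
    (fun _ _ => IsCompactOperator.add) isCompactOperator_zero fun i _ => ?_
  exact (isCompactOperator_of_locallyCompactSpace_dom (innerSL ℂ (y i))).clm_comp
    (ContinuousLinearMap.toSpanSingleton ℂ (x i))

end IsNuclear


theorem sum_norm_inner_mul_inner_le {κ : Type} {b : κ → H} (hb : Orthonormal ℂ b) (x y : H)
    (s : Finset κ) : ∑ n ∈ s, ‖⟪y, b n⟫ * ⟪b n, x⟫‖ ≤ ‖x‖ * ‖y‖ := by
  calc ∑ n ∈ s, ‖⟪y, b n⟫ * ⟪b n, x⟫‖ = ∑ n ∈ s, ‖⟪b n, x⟫‖ * ‖⟪b n, y⟫‖ := by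
        simp_rw [norm_mul, norm_inner_symm y, mul_comm]
    _ ≤ √(∑ n ∈ s, ‖⟪b n, x⟫‖ ^ 2) * √(∑ n ∈ s, ‖⟪b n, y⟫‖ ^ 2) :=
        Real.sum_mul_le_sqrt_mul_sqrt _ _ _
    _ ≤ ‖x‖ * ‖y‖ := by
        gcongr <;> exact Real.sqrt_le_iff.2 ⟨norm_nonneg _, hb.sum_inner_products_le _⟩

theorem summable_norm_inner_mul_inner {κ : Type} {b : κ → H} (hb : Orthonormal ℂ b) (x y : H) :
    Summable fun n => ‖⟪y, b n⟫ * ⟪b n, x⟫‖ :=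
  summable_of_sum_le (fun _ => norm_nonneg _) (sum_norm_inner_mul_inner_le hb x y)

theorem hasSum_inner_apply_of_hasSum_rankOne {ι : Type} {x y : ι → H} {T : H →L[ℂ] H}
    (hs : HasSum (fun i => rankOne ℂ (x i) (y i)) T) (u w : H) :
    HasSum (fun i => ⟪y i, w⟫ * ⟪u, x i⟫) ⟪u, T w⟫ := by
  have h2 := (hs.mapL (ContinuousLinearMap.apply ℂ H w)).mapL (innerSL ℂ u)
  simpa [inner_smul_right] using h2

/-- The trace of a nuclear operator may be computed along any Hilbert basis. -/
theorem hasSum_inner_of_hasSum_rankOne {ι κ : Type} (b : HilbertBasis κ ℂ H) {x y : ι → H}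
    {T : H →L[ℂ] H} (h : Summable fun i => ‖x i‖ * ‖y i‖)
    (hs : HasSum (fun i => rankOne ℂ (x i) (y i)) T) :
    HasSum (fun n => ⟪b n, T (b n)⟫) (∑' i, ⟪y i, x i⟫) := by
  have hsum : Summable fun p : ι × κ => ⟪y p.1, b p.2⟫ * ⟪b p.2, x p.1⟫ := by
    refine Summable.of_norm ((summable_prod_of_nonneg fun _ => norm_nonneg _).2 ⟨fun i => ?_, ?_⟩)
    · exact summable_norm_inner_mul_inner b.orthonormal (x i) (y i)
    · refine Summable.of_nonneg_of_le (fun i => tsum_nonneg fun _ => norm_nonneg _)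
        (fun i => ?_) h
      exact (summable_norm_inner_mul_inner b.orthonormal (x i) (y i)).tsum_le_of_sum_le
        (sum_norm_inner_mul_inner_le b.orthonormal (x i) (y i))
  have h1 : HasSum (fun i => ⟪y i, x i⟫) (∑' p : ι × κ, ⟪y p.1, b p.2⟫ * ⟪b p.2, x p.1⟫) :=
    hsum.hasSum.prod_fiberwise fun i => b.hasSum_inner_mul_inner (y i) (x i)
  rw [h1.tsum_eq]
  have h2 := hsum.hasSum
  rw [← (Equiv.prodComm κ ι).hasSum_iff] at h2
  exact h2.prod_fiberwise fun n => hasSum_inner_apply_of_hasSum_rankOne hs (b n) (b n)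

theorem IsNuclear.hasSum_inner {κ : Type} (e : HilbertBasis ℕ ℂ H) (b : HilbertBasis κ ℂ H)
    {T : H →L[ℂ] H} (hT : IsNuclear T) : HasSum (fun n => ⟪b n, T (b n)⟫) (traceAlong e T) := by
  obtain ⟨ι, x, y, h, hs⟩ := hT
  rw [traceAlong, (hasSum_inner_of_hasSum_rankOne e h hs).tsum_eq]
  exact hasSum_inner_of_hasSum_rankOne b h hs

theorem traceAlong_add (e : HilbertBasis ℕ ℂ H) {S T : H →L[ℂ] H} (hS : IsNuclear S)
    (hT : IsNuclear T) : traceAlong e (S + T) = traceAlong e S + traceAlong e T := by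
  have h := (hS.hasSum_inner e e).add (hT.hasSum_inner e e)
  simpa [traceAlong, inner_add_right] using h.tsum_eq

theorem traceAlong_smul (e : HilbertBasis ℕ ℂ H) (c : ℂ) (T : H →L[ℂ] H) :
    traceAlong e (c • T) = c * traceAlong e T := by
  simp [traceAlong, tsum_mul_left]

theorem traceAlong_sum (e : HilbertBasis ℕ ℂ H) {α : Type*} (s : Finset α)
    {T : α → H →L[ℂ] H} (hT : ∀ a ∈ s, IsNuclear (T a)) :
    traceAlong e (∑ a ∈ s, T a) = ∑ a ∈ s, traceAlong e (T a) := by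
  classical
  induction s using Finset.induction_on with
  | empty => simp [traceAlong]
  | insert a s ha ih =>
    rw [Finset.forall_mem_insert] at hT
    rw [Finset.sum_insert ha, Finset.sum_insert ha,
      traceAlong_add e hT.1 (IsNuclear.sum s hT.2), ih hT.2]

theorem IsNuclear.traceAlong_mul_comm (e : HilbertBasis ℕ ℂ H) {T : H →L[ℂ] H} (hT : IsNuclear T)
    (B : H →L[ℂ] H) : traceAlong e (B * T) = traceAlong e (T * B) := by
  obtain ⟨ι, x, y, h, hs⟩ := hT
  have h1 : HasSum (fun i => rankOne ℂ (B (x i)) (y i)) (B * T) := by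
    simp only [← InnerProductSpace.comp_rankOne]
    exact hs.mul_left B
  have h2 : HasSum (fun i => rankOne ℂ (x i) (star B (y i))) (T * B) := by
    simp only [ContinuousLinearMap.star_eq_adjoint, ← InnerProductSpace.rankOne_comp]
    exact hs.mul_right B
  have h1' : Summable fun i => ‖B (x i)‖ * ‖y i‖ := by
    refine Summable.of_nonneg_of_le (fun i => by positivity) (fun i => ?_) (h.mul_left ‖B‖)
    rw [← mul_assoc]
    gcongr
    exact B.le_opNorm _
  have h2' : Summable fun i => ‖x i‖ * ‖star B (y i)‖ := by
    refine Summable.of_nonneg_of_le (fun i => by positivity) (fun i => ?_) (h.mul_left ‖star B‖)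
    calc ‖x i‖ * ‖star B (y i)‖ ≤ ‖x i‖ * (‖star B‖ * ‖y i‖) := by
          gcongr
          exact (star B).le_opNorm _
      _ = ‖star B‖ * (‖x i‖ * ‖y i‖) := by ring
  rw [traceAlong, (hasSum_inner_of_hasSum_rankOne e h1' h1).tsum_eq, traceAlong,
    (hasSum_inner_of_hasSum_rankOne e h2' h2).tsum_eq]
  simp [ContinuousLinearMap.star_eq_adjoint, ContinuousLinearMap.adjoint_inner_left]

/-- Finite partial sums of the diagonal of a nuclear operator are bounded by its nuclear norm. -/
theorem norm_sum_inner_le {ι κ : Type} {b : κ → H} (hb : Orthonormal ℂ b) {x y : ι → H}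
    {T : H →L[ℂ] H} (h : Summable fun i => ‖x i‖ * ‖y i‖)
    (hs : HasSum (fun i => rankOne ℂ (x i) (y i)) T) (s : Finset κ) :
    ‖∑ n ∈ s, ⟪b n, T (b n)⟫‖ ≤ ∑' i, ‖x i‖ * ‖y i‖ := by
  have h1 : HasSum (fun i => ∑ n ∈ s, ⟪y i, b n⟫ * ⟪b n, x i⟫) (∑ n ∈ s, ⟪b n, T (b n)⟫) :=
    hasSum_sum fun n _ => hasSum_inner_apply_of_hasSum_rankOne hs (b n) (b n)
  refine h1.norm_le_of_bounded h.hasSum fun i => ?_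
  exact (norm_sum_le _ _).trans (sum_norm_inner_mul_inner_le hb (x i) (y i) s)

/-- A bounded approximation `(|T| + ε)⁻¹ T^*` of the polar isometry, with
`(|T| + ε)⁻¹ T^* T = |T|² (|T| + ε)⁻¹` within `ε` of `|T|`. -/
theorem exists_norm_mul_sub_absCLM_le (T : H →L[ℂ] H) {ε : ℝ} (hε : 0 < ε) :
    ∃ W : H →L[ℂ] H, ‖W‖ ≤ 1 ∧ ‖W * T - absCLM T‖ ≤ ε := by
  set P : H →L[ℂ] H := absCLM T with hP
  have hPP : P * P = star T * T := CFC.abs_mul_abs T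
  have hP0 : 0 ≤ P := CFC.abs_nonneg T
  have hPsa : IsSelfAdjoint P := .of_nonneg hP0
  have hspec : ∀ t ∈ spectrum ℝ P, 0 ≤ t := fun t ht => spectrum_nonneg_of_nonneg hP0 ht
  set g : ℝ → ℝ := fun t => (|t| + ε)⁻¹ with hg
  have hgc : Continuous g := by
    refine Continuous.inv₀ (by fun_prop) fun t => ?_
    positivity
  have hPP2 : P * P = cfc (fun t : ℝ => t * t) P := by
    rw [cfc_mul (fun t : ℝ => t) (fun t => t) P, cfc_id' ℝ P]
  have hc2 : Continuous fun t => g t * (t * t) := hgc.mul (by fun_prop)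
  have hgPP : cfc g P * (P * P) = cfc (fun t => g t * (t * t)) P := by
    rw [hPP2, ← cfc_mul g (fun t => t * t) P hgc.continuousOn (by fun_prop)]
  have hgs : star (cfc g P) = cfc g P := (cfc_predicate g P : IsSelfAdjoint _).star_eq
  refine ⟨cfc g P * star T, ?_, ?_⟩
  · have h1 : ‖cfc g P * star T‖ * ‖cfc g P * star T‖ ≤ 1 := by
      rw [← CStarRing.norm_self_mul_star, star_mul, star_star, hgs,
        show cfc g P * star T * (T * cfc g P) = cfc g P * (P * P) * cfc g P by
          rw [hPP]; simp only [mul_assoc],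
        hgPP, ← cfc_mul _ g P hc2.continuousOn hgc.continuousOn]
      refine norm_cfc_le zero_le_one fun t ht => ?_
      have ht0 := hspec t ht
      have : g t * (t * t) * g t = (t / (t + ε)) ^ 2 := by
        simp only [hg, abs_of_nonneg ht0]; field_simp
      rw [this, Real.norm_of_nonneg (by positivity)]
      exact pow_le_one₀ (by positivity) ((div_le_one (by positivity)).2 (by linarith))
    nlinarith [norm_nonneg (cfc g P * star T)]
  · rw [mul_assoc, ← hPP, hgPP]
    conv_lhs => enter [1, 2]; rw [← cfc_id' ℝ P]
    rw [← cfc_sub _ (fun t => t) P hc2.continuousOn (by fun_prop)]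
    refine norm_cfc_le hε.le fun t ht => ?_
    have ht0 := hspec t ht
    have : g t * (t * t) - t = -(ε * (t / (t + ε))) := by
      simp only [hg, abs_of_nonneg ht0]; field_simp; ring
    rw [this, norm_neg, Real.norm_of_nonneg (by positivity)]
    exact mul_le_of_le_one_right hε.le ((div_le_one (by positivity)).2 (by linarith))

theorem IsNuclear.isTraceClass (e : HilbertBasis ℕ ℂ H) {T : H →L[ℂ] H} (hT : IsNuclear T) :
    IsTraceClass e T := by
  obtain ⟨ι, x, y, h, hs⟩ := hT
  have hP0 : 0 ≤ absCLM T := CFC.abs_nonneg T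
  refine summable_of_sum_le (c := ∑' i, ‖x i‖ * ‖y i‖)
    (fun n => ((ContinuousLinearMap.nonneg_iff_isPositive _).1 hP0).re_inner_nonneg_right _)
    fun s => ?_
  refine le_of_forall_pos_le_add fun δ hδ => ?_
  set ε : ℝ := δ / (s.card + 1) with hε
  have hε0 : 0 < ε := by positivity
  obtain ⟨W, hW1, hW2⟩ := exists_norm_mul_sub_absCLM_le T hε0
  have hn : ∀ n, (⟪e n, absCLM T (e n)⟫).re ≤ (⟪e n, (W * T) (e n)⟫).re + ε := fun n => by
    have h1 : ‖⟪e n, (W * T - absCLM T) (e n)⟫‖ ≤ ε := by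
      refine (norm_inner_le_norm _ _).trans ?_
      rw [e.orthonormal.1 n, one_mul]
      refine (ContinuousLinearMap.le_opNorm _ _).trans ?_
      rwa [e.orthonormal.1 n, mul_one]
    have h2 := (abs_le.1 ((Complex.abs_re_le_norm _).trans h1)).1
    rw [sub_apply, inner_sub_right, Complex.sub_re] at h2
    linarith
  have hWT : HasSum (fun i => rankOne ℂ (W (x i)) (y i)) (W * T) := by
    simp only [← InnerProductSpace.comp_rankOne]
    exact hs.mul_left W
  have hle : ∀ i, ‖W (x i)‖ * ‖y i‖ ≤ ‖x i‖ * ‖y i‖ := fun i => by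
    gcongr
    exact W.le_of_opNorm_le_of_le hW1 le_rfl |>.trans_eq (one_mul _)
  have hsum : Summable fun i => ‖W (x i)‖ * ‖y i‖ :=
    Summable.of_nonneg_of_le (fun i => by positivity) hle h
  calc ∑ n ∈ s, (⟪e n, absCLM T (e n)⟫).re
      ≤ ∑ n ∈ s, ((⟪e n, (W * T) (e n)⟫).re + ε) := Finset.sum_le_sum fun n _ => hn n
    _ = (∑ n ∈ s, ⟪e n, (W * T) (e n)⟫).re + s.card * ε := by
        rw [Finset.sum_add_distrib, Complex.re_sum]; simp
    _ ≤ ∑' i, ‖x i‖ * ‖y i‖ + δ := by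
        gcongr
        · refine (Complex.re_le_norm _).trans ?_
          exact (norm_sum_inner_le e.orthonormal hsum hWT s).trans (hsum.tsum_le_tsum hle h)
        · rw [hε, mul_div_assoc', div_le_iff₀ (by positivity)]
          nlinarith

theorem isNuclear_mul_star {κ : Type} (e : HilbertBasis κ ℂ H) {S : H →L[ℂ] H}
    (h : Summable fun n => ‖S (e n)‖ ^ 2) : IsNuclear (S * star S) := by
  have h' : Summable fun n => ‖S (e n)‖ * ‖S (e n)‖ := by simpa [sq] using h
  have hs : Summable fun n => rankOne ℂ (S (e n)) (S (e n)) := Summable.of_norm (by simpa using h')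
  refine ⟨κ, fun n => S (e n), fun n => S (e n), h', ?_⟩
  convert hs.hasSum
  refine ContinuousLinearMap.ext fun w => ?_
  refine ext_inner_left ℂ fun u => ?_
  refine HasSum.unique ?_ (hasSum_inner_apply_of_hasSum_rankOne hs.hasSum u w)
  have h1 := e.hasSum_inner_mul_inner (star S u) (star S w)
  rw [ContinuousLinearMap.star_eq_adjoint, ContinuousLinearMap.adjoint_inner_left] at h1
  simp only [ContinuousLinearMap.adjoint_inner_left, ContinuousLinearMap.adjoint_inner_right]
    at h1
  simpa only [mul_comm] using! h1

theorem IsSchatten3.isNuclear_absCLM_pow {e : HilbertBasis ℕ ℂ H} {V : H →L[ℂ] H}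
    (hV : IsSchatten3 e V) : IsNuclear (absCLM V ^ 3) := by
  have hP0 : 0 ≤ absCLM V := CFC.abs_nonneg V
  set P := absCLM V with hP
  have hQ : CFC.sqrt P * CFC.sqrt P = P := CFC.sqrt_mul_sqrt_self P
  have hS : star (CFC.sqrt P ^ 3) = CFC.sqrt P ^ 3 :=
    ((IsSelfAdjoint.of_nonneg (CFC.sqrt_nonneg P)).pow 3).star_eq
  have hSS : CFC.sqrt P ^ 3 * CFC.sqrt P ^ 3 = P ^ 3 := by
    rw [← (Commute.refl (CFC.sqrt P)).mul_pow, hQ]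
  have : IsNuclear (CFC.sqrt P ^ 3 * star (CFC.sqrt P ^ 3)) := by
    refine isNuclear_mul_star e (hV.congr fun n => ?_)
    rw [← hSS, mul_apply_eq_comp, ← ContinuousLinearMap.adjoint_inner_left,
      ← ContinuousLinearMap.star_eq_adjoint, hS]
    exact inner_self_eq_norm_sq (𝕜 := ℂ) _
  rwa [hS, hSS] at this

theorem isCompactOperator_of_pow_four {V : H →L[ℂ] H} (hV : IsSelfAdjoint V)
    (h : IsCompactOperator (V ^ 4 : H →L[ℂ] H)) : IsCompactOperator V := by
  have hcl : IsClosed {S : H →L[ℂ] H | IsCompactOperator S} :=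
    isClosed_setOfPred_isCompactOperator
  suffices hmem : V ∈ closure {S : H →L[ℂ] H | IsCompactOperator S} by
    rw [hcl.closure_eq] at hmem
    exact hmem
  refine Metric.mem_closure_iff.2 fun ε hε => ?_
  obtain ⟨δ, hδ, hδε⟩ := exists_between hε
  set g : ℝ → ℝ := fun t => t / (t ^ 4 + δ ^ 4) with hg
  have hgc : Continuous g := by
    refine Continuous.div (by fun_prop) (by fun_prop) fun t => ?_
    positivity
  have hcomp : IsCompactOperator (V ^ 4 * cfc g V : H →L[ℂ] H) := h.comp_clm (cfc g V)
  refine ⟨V ^ 4 * cfc g V, hcomp, ?_⟩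
  refine lt_of_le_of_lt ?_ hδε
  have hmul : V ^ 4 * cfc g V = cfc (fun t => t ^ 4 * g t) V := by
    rw [cfc_mul (fun t => t ^ 4) g V (by fun_prop) hgc.continuousOn, cfc_pow_id V 4]
  have hc2 : Continuous fun t => t ^ 4 * g t := by fun_prop
  rw [dist_eq_norm, hmul]
  conv_lhs => enter [1, 1]; rw [← cfc_id' ℝ V]
  rw [← cfc_sub (fun t => t) _ V (by fun_prop) hc2.continuousOn]
  refine norm_cfc_le hδ.le fun t _ => ?_
  have : t - t ^ 4 * g t = t * δ ^ 4 / (t ^ 4 + δ ^ 4) := by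
    simp only [hg]; field_simp; ring
  rw [this, norm_div, norm_mul, Real.norm_of_nonneg (by positivity : 0 ≤ δ ^ 4),
    Real.norm_of_nonneg (by positivity : 0 ≤ t ^ 4 + δ ^ 4), div_le_iff₀ (by positivity),
    Real.norm_eq_abs, ← Even.pow_abs (by decide : Even 4) t]
  rcases le_total |t| δ with h1 | h1
  · nlinarith [pow_nonneg (abs_nonneg t) 4, mul_le_mul_of_nonneg_right h1 (pow_nonneg hδ.le 4)]
  · have h3 : δ ^ 3 ≤ |t| ^ 3 := by gcongr
    have h4 := mul_le_mul_of_nonneg_left h3 (mul_nonneg (abs_nonneg t) hδ.le)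
    nlinarith [pow_nonneg hδ.le 5]

theorem exists_hilbertBasis_apply_eq_smul {V : H →L[ℂ] H} (hV : IsSelfAdjoint V)
    (hc : IsCompactOperator V) :
    ∃ (ι : Type) (b : HilbertBasis ι ℂ H) (l : ι → ℝ), ∀ i, V (b i) = (l i : ℂ) • b i := by
  have hsym : (V : H →ₗ[ℂ] H).IsSymmetric := hV.isSymmetric
  set E : ℂ → Submodule ℂ H := fun μ => Module.End.eigenspace (V : H →ₗ[ℂ] H) μ with hE
  have hcomp : ∀ μ, CompleteSpace (E μ) := fun μ => by
    have : IsClosed {x : H | V x = μ • x} := isClosed_eq (by fun_prop) (by fun_prop)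
    refine IsClosed.completeSpace_coe (hs := ?_)
    convert this using 1
    ext x
    simp [hE]
  choose w B hB using fun μ => exists_hilbertBasis ℂ (E μ)
  have hfam : OrthogonalFamily ℂ (fun μ => E μ) fun μ => (E μ).subtypeₗᵢ :=
    hsym.orthogonalFamily_eigenspaces
  have hon := hfam.orthonormal_sigma_orthonormal fun μ => (B μ).orthonormal
  have hbot : (Submodule.span ℂ
      (Set.range fun a : Σ μ, w μ => (E a.1).subtypeₗᵢ (B a.1 a.2)))ᗮ = ⊥ := by
    rw [eq_bot_iff, ← ContinuousLinearMap.orthogonalComplement_iSup_eigenspaces_eq_bot hc hsym]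
    intro x hx
    rw [Submodule.mem_orthogonal'] at hx
    suffices h : ⨆ μ, E μ ≤ (Submodule.span ℂ {x})ᗮ from fun y hy =>
      inner_eq_zero_symm.1 (Submodule.mem_orthogonal_singleton_iff_inner_right.1 (h hy))
    refine iSup_le fun μ y hy => Submodule.mem_orthogonal_singleton_iff_inner_right.2 ?_
    have h1 := (((B μ).hasSum_repr ⟨y, hy⟩).mapL (E μ).subtypeL).mapL (innerSL ℂ x)
    refine h1.unique ?_
    convert hasSum_zero with i
    have h2 := hx _ (Submodule.subset_span ⟨⟨μ, i⟩, rfl⟩)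
    simp only [map_smul, innerSL_apply_apply, smul_eq_mul, Submodule.subtypeL_apply]
    exact mul_eq_zero_of_right _ h2
  refine ⟨Σ μ, w μ, HilbertBasis.mkOfOrthogonalEqBot hon hbot, fun a => a.1.re, fun a => ?_⟩
  rw [HilbertBasis.coe_mkOfOrthogonalEqBot]
  set x : H := ((B a.1 a.2 : E a.1) : H) with hx
  have hVx : V x = a.1 • x := Module.End.mem_eigenspace_iff.1 (B a.1 a.2).2
  have hx1 : ‖x‖ = 1 := (B a.1).orthonormal.1 a.2
  have hre : (a.1.re : ℂ) = a.1 := by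
    have h := hsym x x
    simp only [ContinuousLinearMap.coe_coe, hVx, inner_smul_left, inner_smul_right,
      inner_self_eq_norm_sq_to_K, hx1] at h
    exact Complex.conj_eq_iff_re.1 (by simpa using h)
  rw [hre]
  exact hVx

theorem absCLM_apply_of_apply_eq_smul {V : H →L[ℂ] H} (hV : IsSelfAdjoint V) {x : H} {l : ℝ}
    (hx : V x = (l : ℂ) • x) : absCLM V x = ((|l| : ℝ) : ℂ) • x := by
  set P : H →L[ℂ] H := absCLM V with hP
  have hPP : P * P = V * V := by
    rw [show P * P = star V * V from CFC.abs_mul_abs V, hV.star_eq]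
  have hP0 : 0 ≤ P := CFC.abs_nonneg V
  have hPsa : star P = P := (IsSelfAdjoint.of_nonneg hP0).star_eq
  have hPPx : P (P x) = ((|l| : ℝ) : ℂ) • ((|l| : ℝ) : ℂ) • x := by
    have := congrArg (fun T : H →L[ℂ] H => T x) hPP
    simp only [mul_apply_eq_comp, hx, map_smul] at this
    rw [this, smul_smul, smul_smul, ← Complex.ofReal_mul, ← Complex.ofReal_mul, abs_mul_abs_self]
  set w := P x - ((|l| : ℝ) : ℂ) • x with hw
  have hPw : P w = -(((|l| : ℝ) : ℂ) • w) := by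
    rw [hw, map_sub, map_smul, hPPx, smul_sub]; abel
  have hpos : 0 ≤ (⟪w, P w⟫).re :=
    ((ContinuousLinearMap.nonneg_iff_isPositive _).1 hP0).re_inner_nonneg_right w
  rw [hPw, inner_neg_right, inner_smul_right, inner_self_eq_norm_sq_to_K] at hpos
  have hpos' : |l| * ‖w‖ ^ 2 ≤ 0 := by
    have : (-(((|l| : ℝ) : ℂ) * ((‖w‖ : ℂ)) ^ 2)).re = -(|l| * ‖w‖ ^ 2) := by norm_cast
    have h' : 0 ≤ -(|l| * ‖w‖ ^ 2) := this ▸ hpos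
    linarith
  suffices h : w = 0 from sub_eq_zero.1 h
  rcases eq_or_ne l 0 with rfl | hl
  · have h1 : ⟪P x, P x⟫ = 0 := by
      rw [← ContinuousLinearMap.adjoint_inner_right, ← ContinuousLinearMap.star_eq_adjoint, hPsa,
        hPPx]
      simp
    simp [hw, inner_self_eq_zero.1 h1]
  · have : ‖w‖ ^ 2 ≤ 0 := nonpos_of_mul_nonpos_right hpos' (abs_pos.2 hl)
    simpa using le_antisymm this (by positivity)

/-- A self-adjoint operator in the Schatten 3-class is diagonal in some Hilbert basis, with
cube-summable eigenvalues. -/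
theorem IsSchatten3.exists_eigenbasis {e : HilbertBasis ℕ ℂ H} {V : H →L[ℂ] H}
    (hV3 : IsSchatten3 e V) (hV : IsSelfAdjoint V) :
    ∃ (ι : Type) (b : HilbertBasis ι ℂ H) (l : ι → ℝ), (∀ i, V (b i) = (l i : ℂ) • b i) ∧
      Summable fun i => |l i| ^ 3 := by
  have hnuc := hV3.isNuclear_absCLM_pow
  have hV4 : IsCompactOperator (V ^ 4 : H →L[ℂ] H) := by
    have : absCLM V * absCLM V = V * V := by
      rw [show absCLM V * absCLM V = star V * V from CFC.abs_mul_abs V, hV.star_eq]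
    have h4 : V ^ 4 = absCLM V ^ 3 * absCLM V := by
      rw [← pow_succ, show 3 + 1 = 2 * 2 from rfl, pow_mul, sq (absCLM V), this, ← sq, ← pow_mul]
    rw [h4]
    exact hnuc.isCompactOperator.comp_clm _
  obtain ⟨ι, b, l, hl⟩ := exists_hilbertBasis_apply_eq_smul hV (isCompactOperator_of_pow_four hV hV4)
  refine ⟨ι, b, l, hl, ?_⟩
  have hs := (Complex.hasSum_re (hnuc.hasSum_inner e b)).summable
  refine hs.congr fun i => ?_
  have h1 := absCLM_apply_of_apply_eq_smul hV (hl i)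
  have h3 : (absCLM V ^ 3) (b i) = ((|l i| ^ 3 : ℝ) : ℂ) • b i := by
    simp only [pow_succ, pow_zero, one_mul, mul_apply_eq_comp, h1, map_smul, smul_smul]
    push_cast
    ring_nf
  rw [h3, inner_smul_right, inner_self_eq_norm_sq_to_K, b.orthonormal.1 i, RCLike.ofReal_one,
    one_pow, mul_one, Complex.ofReal_re]

/-- Bounded multipliers along a Hilbert basis are bounded operators. -/
theorem HilbertBasis.exists_diagonal {ι : Type} (b : HilbertBasis ι ℂ H) {c : ι → ℝ} {K : ℝ}
    (hK : 0 ≤ K) (hc : ∀ i, |c i| ≤ K) :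
    ∃ D : H →L[ℂ] H, ‖D‖ ≤ K ∧ ∀ i x, ⟪b i, D x⟫ = c i * ⟪b i, x⟫ := by
  have hb : ∀ (x : lp (fun _ : ι => ℂ) 2) i,
      ‖(c i : ℂ) * x i‖ ≤ ‖((K : ℂ) • x : lp (fun _ : ι => ℂ) 2) i‖ := fun x i => by
    simp only [lp.coeFn_smul, Pi.smul_apply, smul_eq_mul, norm_mul, Complex.norm_real,
      Real.norm_eq_abs, abs_of_nonneg hK]
    gcongr
    exact hc i
  have hmem : ∀ x : lp (fun _ : ι => ℂ) 2, Memℓp (fun i => (c i : ℂ) * x i) 2 := fun x =>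
    (lp.memℓp ((K : ℂ) • x)).mono' (hb x)
  choose M hM using fun x => (⟨⟨_, hmem x⟩, fun _ => rfl⟩ :
    ∃ y : lp (fun _ : ι => ℂ) 2, ∀ i, y i = (c i : ℂ) * x i)
  have hMn : ∀ x, ‖M x‖ ≤ K * ‖x‖ := fun x => by
    have : ‖M x‖ ≤ ‖(K : ℂ) • x‖ := lp.norm_mono two_ne_zero fun i => (hM x i).symm ▸ hb x i
    rwa [norm_smul, Complex.norm_real, Real.norm_of_nonneg hK] at this
  let D : H →ₗ[ℂ] H :=
    { toFun := fun x => b.repr.symm (M (b.repr x))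
      map_add' := fun x y => by
        rw [← map_add]
        congr 1
        ext i
        simp [hM, mul_add]
      map_smul' := fun a x => by
        rw [RingHom.id_apply, ← map_smul]
        congr 1
        ext i
        simp only [hM, map_smul, lp.coeFn_smul, Pi.smul_apply, smul_eq_mul]
        ring }
  have hD : ∀ x, ‖D x‖ ≤ K * ‖x‖ := fun x => by
    simpa [D] using hMn (b.repr x)
  refine ⟨D.mkContinuous K hD, D.mkContinuous_norm_le hK hD, fun i x => ?_⟩
  rw [← b.repr_apply_apply, ← b.repr_apply_apply]
  simp [D, hM]

section Diagonal

variable {ι : Type} {b : HilbertBasis ι ℂ H}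

theorem HilbertBasis.ext_inner_left (b : HilbertBasis ι ℂ H) {x y : H}
    (h : ∀ i, ⟪b i, x⟫ = ⟪b i, y⟫) : x = y := by
  refine b.repr.injective (lp.ext (funext fun i => ?_))
  rw [b.repr_apply_apply, b.repr_apply_apply, h]

theorem HilbertBasis.ext_clm (b : HilbertBasis ι ℂ H) {S T : H →L[ℂ] H}
    (h : ∀ i j, ⟪b i, S (b j)⟫ = ⟪b i, T (b j)⟫) : S = T := by
  refine ContinuousLinearMap.ext_on (s := Set.range b) ?_ ?_
  · exact Submodule.dense_iff_topologicalClosure_eq_top.2 b.dense_span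
  · rintro _ ⟨j, rfl⟩
    exact b.ext_inner_left fun i => h i j

/-- `D` acts on the Hilbert basis `b` as multiplication by `c`. -/
def IsDiagonal (b : HilbertBasis ι ℂ H) (D : H →L[ℂ] H) (c : ι → ℝ) : Prop :=
  ∀ i x, ⟪b i, D x⟫ = (c i : ℂ) * ⟪b i, x⟫

theorem IsDiagonal.apply_self {D : H →L[ℂ] H} {c : ι → ℝ} (hD : IsDiagonal b D c) (i : ι) :
    D (b i) = (c i : ℂ) • b i := by
  classical
  refine b.ext_inner_left fun j => ?_
  rw [hD, inner_smul_right, orthonormal_iff_ite.1 b.orthonormal]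
  split_ifs with h <;> simp [h]

theorem IsDiagonal.hasSum_inner {D : H →L[ℂ] H} {c : ι → ℝ} (hD : IsDiagonal b D c)
    (B : H →L[ℂ] H) (x y : H) :
    HasSum (fun i => (c i : ℂ) * (⟪x, B (b i)⟫ * ⟪b i, y⟫)) ⟪x, B (D y)⟫ := by
  have h := b.hasSum_inner_mul_inner (star B x) (D y)
  simp only [ContinuousLinearMap.star_eq_adjoint, ContinuousLinearMap.adjoint_inner_left,
    hD _ _] at h
  simpa only [mul_left_comm] using h

/-- If `V` is diagonal with cube-summable eigenvalues, then `V B V C V` is nuclear for all bounded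
`B` and `C`. The matrix of the product is split according to which of the three eigenvalues has the
largest modulus. -/
theorem IsDiagonal.isNuclear_mul_mul {l : ι → ℝ} {V : H →L[ℂ] H} (hV : IsDiagonal b V l)
    (hl : Summable fun i => |l i| ^ 3) (B C : H →L[ℂ] H) : IsNuclear (V * B * V * C * V) := by
  classical
  set p : ι → ι → ℝ := fun m i => if |l i| ≤ |l m| then l i else 0 with hp
  set q : ι → ι → ℝ := fun m i => if |l i| < |l m| then l i else 0 with hq
  have hle : ∀ m, ∃ D : H →L[ℂ] H, ‖D‖ ≤ |l m| ∧ IsDiagonal b D (p m) := fun m => by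
    refine b.exists_diagonal (abs_nonneg _) fun i => ?_
    simp only [hp]
    split_ifs with h <;> simp [h]
  have hlt : ∀ m, ∃ D : H →L[ℂ] H, ‖D‖ ≤ |l m| ∧ IsDiagonal b D (q m) := fun m => by
    refine b.exists_diagonal (abs_nonneg _) fun i => ?_
    simp only [hq]
    split_ifs with h
    · exact h.le
    · simp
  choose P hPn hP using hle
  choose Q hQn hQ using hlt
  have hb : ∀ i, ‖b i‖ = 1 := b.orthonormal.1
  set x₁ : ι → H := fun i => (l i : ℂ) • b i with hx₁
  set y₁ : ι → H := fun i => star (B * P i * C * P i) (b i) with hy₁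
  set x₂ : ι → H := fun i => (l i : ℂ) • (Q i * B) (b i) with hx₂
  set y₂ : ι → H := fun i => star (C * P i) (b i) with hy₂
  set x₃ : ι → H := fun i => (l i : ℂ) • (Q i * B * Q i * C) (b i) with hx₃
  have hbd : ∀ (X : H →L[ℂ] H) i, ‖X (b i)‖ ≤ ‖X‖ := fun X i => X.unit_le_opNorm _ (hb i).le
  have hs₁ : Summable fun i => ‖x₁ i‖ * ‖y₁ i‖ := by
    refine Summable.of_nonneg_of_le (fun _ => by positivity) (fun i => ?_)
      (hl.mul_left (‖B‖ * ‖C‖))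
    have h1 : ‖x₁ i‖ = |l i| := by simp [hx₁, norm_smul, hb]
    have h2 : ‖y₁ i‖ ≤ ‖B‖ * |l i| * ‖C‖ * |l i| := by
      refine (hbd _ i).trans ?_
      rw [norm_star]
      exact norm_mul_le_of_le (norm_mul_le_of_le (norm_mul_le_of_le le_rfl (hPn i)) le_rfl)
        (hPn i)
    calc ‖x₁ i‖ * ‖y₁ i‖ ≤ |l i| * (‖B‖ * |l i| * ‖C‖ * |l i|) := by rw [h1]; gcongr
      _ = _ := by ring
  have hs₂ : Summable fun i => ‖x₂ i‖ * ‖y₂ i‖ := by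
    refine Summable.of_nonneg_of_le (fun _ => by positivity) (fun i => ?_)
      (hl.mul_left (‖B‖ * ‖C‖))
    have h1 : ‖x₂ i‖ ≤ |l i| * (|l i| * ‖B‖) := by
      rw [hx₂, norm_smul, Complex.norm_real, Real.norm_eq_abs]
      gcongr
      exact (hbd _ i).trans (norm_mul_le_of_le (hQn i) le_rfl)
    have h2 : ‖y₂ i‖ ≤ ‖C‖ * |l i| := by
      refine (hbd _ i).trans ?_
      rw [norm_star]
      exact norm_mul_le_of_le le_rfl (hPn i)
    calc ‖x₂ i‖ * ‖y₂ i‖ ≤ |l i| * (|l i| * ‖B‖) * (‖C‖ * |l i|) := by gcongr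
      _ = _ := by ring
  have hs₃ : Summable fun i => ‖x₃ i‖ * ‖b i‖ := by
    refine Summable.of_nonneg_of_le (fun _ => by positivity) (fun i => ?_)
      (hl.mul_left (‖B‖ * ‖C‖))
    have h1 : ‖x₃ i‖ ≤ |l i| * (|l i| * ‖B‖ * |l i| * ‖C‖) := by
      rw [hx₃, norm_smul, Complex.norm_real, Real.norm_eq_abs]
      gcongr
      exact (hbd _ i).trans (norm_mul_le_of_le (norm_mul_le_of_le (norm_mul_le_of_le (hQn i)
        le_rfl) (hQn i)) le_rfl)
    calc ‖x₃ i‖ * ‖b i‖ ≤ |l i| * (|l i| * ‖B‖ * |l i| * ‖C‖) := by rw [hb, mul_one]; exact h1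
      _ = _ := by ring
  have hT₁ := (Summable.of_norm (f := fun i => rankOne ℂ (x₁ i) (y₁ i)) (by simpa using hs₁)).hasSum
  have hT₂ := (Summable.of_norm (f := fun i => rankOne ℂ (x₂ i) (y₂ i)) (by simpa using hs₂)).hasSum
  have hT₃ := (Summable.of_norm (f := fun i => rankOne ℂ (x₃ i) (b i)) (by simpa using hs₃)).hasSum
  set T₁ := ∑' i, rankOne ℂ (x₁ i) (y₁ i)
  set T₂ := ∑' i, rankOne ℂ (x₂ i) (y₂ i)
  set T₃ := ∑' i, rankOne ℂ (x₃ i) (b i)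
  suffices h : V * B * V * C * V = T₁ + T₂ + T₃ by
    rw [h]
    exact (IsNuclear.add ⟨ι, x₁, y₁, hs₁, hT₁⟩ ⟨ι, x₂, y₂, hs₂, hT₂⟩).add ⟨ι, x₃, b, hs₃, hT₃⟩
  refine b.ext_clm fun m n => ?_
  set w : ι → ℂ := fun j => ⟪b m, B (b j)⟫ * ⟪b j, C (b n)⟫ with hw
  have hV' : HasSum (fun j => (l m * l n : ℂ) * (l j * w j)) ⟪b m, (V * B * V * C * V) (b n)⟫ := by
    have h := (hV.hasSum_inner B (b m) (C (b n))).mul_left (l m * l n : ℂ)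
    have heq : ⟪b m, (V * B * V * C * V) (b n)⟫ = (l m * l n : ℂ) * ⟪b m, B (V (C (b n)))⟫ := by
      simp only [mul_apply_eq_comp, hV m, hV.apply_self n, map_smul, inner_smul_right]
      ring
    rw [heq]
    exact h
  have h₁ : HasSum (fun j => (l m * p m n : ℂ) * (p m j * w j)) ⟪b m, T₁ (b n)⟫ := by
    have h := ((hP m).hasSum_inner B (b m) (C (b n))).mul_left (l m * p m n : ℂ)
    have heq : ⟪b m, T₁ (b n)⟫ = (l m * p m n : ℂ) * ⟪b m, B (P m (C (b n)))⟫ := by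
      rw [(hasSum_inner_apply_of_hasSum_rankOne hT₁ (b m) (b n)).unique (hasSum_single m ?_)]
      · simp only [hx₁, hy₁, ContinuousLinearMap.star_eq_adjoint,
          ContinuousLinearMap.adjoint_inner_left, mul_apply_eq_comp, (hP m).apply_self n, map_smul,
          inner_smul_right, inner_self_eq_norm_sq_to_K, hb]
        simp
        ring
      · intro i hi
        simp only [hx₁, inner_smul_right, b.orthonormal.2 hi.symm, mul_zero]
    rw [heq]
    exact h
  have h₂ : HasSum (fun j => (l j * p j n * q j m : ℂ) * w j) ⟪b m, T₂ (b n)⟫ := by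
    convert hasSum_inner_apply_of_hasSum_rankOne hT₂ (b m) (b n) using 2 with j
    simp only [hx₂, hy₂, ContinuousLinearMap.star_eq_adjoint,
      ContinuousLinearMap.adjoint_inner_left, mul_apply_eq_comp, (hP j).apply_self n, map_smul,
      inner_smul_right, hQ j m, hw]
    ring
  have h₃ : HasSum (fun j => (l n * q n m : ℂ) * (q n j * w j)) ⟪b m, T₃ (b n)⟫ := by
    have h := ((hQ n).hasSum_inner B (b m) (C (b n))).mul_left (l n * q n m : ℂ)
    have heq : ⟪b m, T₃ (b n)⟫ = (l n * q n m : ℂ) * ⟪b m, B (Q n (C (b n)))⟫ := by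
      rw [(hasSum_inner_apply_of_hasSum_rankOne hT₃ (b m) (b n)).unique (hasSum_single n ?_)]
      · simp only [hx₃, mul_apply_eq_comp, hQ n m, inner_smul_right, inner_self_eq_norm_sq_to_K, hb]
        simp
        ring
      · intro i hi
        simp only [b.orthonormal.2 hi, zero_mul]
    rw [heq]
    exact h
  rw [add_apply, add_apply, inner_add_right, inner_add_right]
  refine hV'.unique ?_
  convert (h₁.add h₂).add h₃ using 2 with j
  have key : l m * l n * l j = l m * p m n * p m j + l j * p j n * q j m + l n * q n m * q n j := by
    simp only [hp, hq]
    split_ifs <;> first | (exfalso; linarith) | ring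
  have key' : (l m * l n * l j : ℂ) =
      l m * p m n * p m j + l j * p j n * q j m + l n * q n m * q n j := by exact_mod_cast key
  linear_combination w j * key'

/-- For `V` diagonal, the trace of `V X` along the eigenbasis equals that of `X V` term by term. -/
theorem IsDiagonal.traceAlong_mul_comm {l : ι → ℝ} {V : H →L[ℂ] H} (hV : IsDiagonal b V l)
    (e : HilbertBasis ℕ ℂ H) {X : H →L[ℂ] H} (h₁ : IsNuclear (V * X)) (h₂ : IsNuclear (X * V)) :
    traceAlong e (V * X) = traceAlong e (X * V) := by
  refine (h₁.hasSum_inner e b).unique ?_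
  convert h₂.hasSum_inner e b using 2 with i
  simp only [mul_apply_eq_comp, hV i, hV.apply_self i, map_smul, inner_smul_right]

end Diagonal

theorem IsSchatten3.exists_isDiagonal {e : HilbertBasis ℕ ℂ H} {V : H →L[ℂ] H}
    (hV3 : IsSchatten3 e V) (hV : IsSelfAdjoint V) :
    ∃ (ι : Type) (b : HilbertBasis ι ℂ H) (l : ι → ℝ), IsDiagonal b V l ∧
      Summable fun i => |l i| ^ 3 := by
  obtain ⟨ι, b, l, h, hl⟩ := hV3.exists_eigenbasis hV
  refine ⟨ι, b, l, fun i x => ?_, hl⟩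
  rw [← ContinuousLinearMap.adjoint_inner_left, ← ContinuousLinearMap.star_eq_adjoint, hV.star_eq,
    h, inner_smul_left, Complex.conj_ofReal]

section Polynomials

open Polynomial

section Line

variable {R : Type*} [Ring R]

theorem derivative_pow_line (A V : R) (n : ℕ) :
    derivative ((C A + X * C V) ^ n) =
      ∑ k ∈ Finset.range n, (C A + X * C V) ^ (n - 1 - k) * C V * (C A + X * C V) ^ k := by
  induction n with
  | zero => simp
  | succ n ih =>
    rw [pow_succ, derivative_mul, ih, Finset.sum_range_succ', Finset.sum_mul]
    congr 1
    · refine Finset.sum_congr rfl fun k _ => ?_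
      rw [mul_assoc, ← pow_succ, show n + 1 - 1 - (k + 1) = n - 1 - k by omega]
    · simp

theorem coeff_zero_pow_line (A V : R) (n : ℕ) : ((C A + X * C V) ^ n).coeff 0 = A ^ n := by
  induction n with
  | zero => simp
  | succ n ih => rw [pow_succ, mul_coeff_zero, ih]; simp [pow_succ]

theorem natDegree_pow_line_le (A V : R) (n : ℕ) : ((C A + X * C V) ^ n).natDegree ≤ n := by
  refine natDegree_pow_le_of_le n (m := 1) ?_ |>.trans (by simp)
  refine natDegree_add_le_of_degree_le (by simp) ?_
  exact natDegree_mul_le.trans (by simpa using natDegree_X_le)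

end Line

section Filtration

variable {R : Type*} [Ring R] [Algebra ℂ R]

/-- The linear span of the products having at least `m` factors equal to `V`. -/
def factorSpan (V : R) : ℕ → Submodule ℂ R
  | 0 => ⊤
  | m + 1 => Submodule.span ℂ {Y | ∃ X ∈ factorSpan V m, ∃ B, Y = X * V * B}

namespace factorSpan

variable {V : R}

theorem mul_mul_mem {m : ℕ} {X : R} (hX : X ∈ factorSpan V m) (B : R) :
    X * V * B ∈ factorSpan V (m + 1) :=
  Submodule.subset_span ⟨X, hX, B, rfl⟩

theorem self_mem (V : R) : V ∈ factorSpan V 1 := by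
  simpa using mul_mul_mem (V := V) (m := 0) (X := 1) Submodule.mem_top 1

theorem induction {m : ℕ} {Q : R → Prop}
    (gen : ∀ X ∈ factorSpan V m, ∀ B, Q (X * V * B)) (zero : Q 0)
    (add : ∀ X ∈ factorSpan V (m + 1), ∀ Y ∈ factorSpan V (m + 1), Q X → Q Y → Q (X + Y))
    (smul : ∀ (c : ℂ), ∀ X ∈ factorSpan V (m + 1), Q X → Q (c • X))
    {X : R} (hX : X ∈ factorSpan V (m + 1)) : Q X := by
  refine Submodule.span_induction (p := fun X _ => Q X) ?_ zero (fun X Y hX hY => add X hX Y hY) smul hX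
  rintro _ ⟨X, hX, B, rfl⟩
  exact gen X hX B

theorem mul_mem_left {m : ℕ} (B : R) {X : R} (hX : X ∈ factorSpan V m) :
    B * X ∈ factorSpan V m := by
  induction m generalizing X with
  | zero => exact Submodule.mem_top
  | succ m ih =>
    refine induction (Q := fun X => B * X ∈ factorSpan V (m + 1)) (fun X hX D => ?_) ?_ ?_ ?_ hX
    · simpa only [mul_assoc] using mul_mul_mem (ih hX) D
    · simp
    · intro X _ Y _ h1 h2
      rw [mul_add]
      exact add_mem h1 h2
    · intro c X _ h
      rw [mul_smul_comm]
      exact Submodule.smul_mem _ _ h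

theorem mul_mem_right {m : ℕ} (B : R) {X : R} (hX : X ∈ factorSpan V m) :
    X * B ∈ factorSpan V m := by
  cases m with
  | zero => exact Submodule.mem_top
  | succ m =>
    refine induction (Q := fun X => X * B ∈ factorSpan V (m + 1)) (fun X hX D => ?_) ?_ ?_ ?_ hX
    · rw [mul_assoc _ D B]
      exact mul_mul_mem hX _
    · simp
    · intro X _ Y _ h1 h2
      rw [add_mul]
      exact add_mem h1 h2
    · intro c X _ h
      rw [smul_mul_assoc]
      exact Submodule.smul_mem _ _ h

theorem succ_le (m : ℕ) : factorSpan V (m + 1) ≤ factorSpan V m := fun X hX => by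
  refine induction (Q := fun X => X ∈ factorSpan V m) (fun X hX D => ?_) ?_ ?_ ?_ hX
  · exact mul_mem_right D (mul_mem_right V hX)
  · exact zero_mem _
  · intro X _ Y _ h1 h2
    exact add_mem h1 h2
  · intro c X _ h
    exact Submodule.smul_mem _ _ h

theorem antitone : Antitone (factorSpan V) :=
  antitone_nat_of_succ_le succ_le

theorem mul_mem {i j : ℕ} {X Y : R} (hX : X ∈ factorSpan V i) (hY : Y ∈ factorSpan V j) :
    X * Y ∈ factorSpan V (i + j) := by
  induction j generalizing Y with
  | zero => exact mul_mem_right Y hX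
  | succ j ih =>
    refine induction (Q := fun Y => X * Y ∈ factorSpan V (i + j + 1))
      (fun Y hY D => ?_) ?_ ?_ ?_ hY
    · simpa only [mul_assoc] using mul_mul_mem (ih hY) D
    · simp
    · intro Y _ Z _ h1 h2
      rw [mul_add]
      exact add_mem h1 h2
    · intro c Y _ h
      rw [mul_smul_comm]
      exact Submodule.smul_mem _ _ h

end factorSpan

/-- The coefficient of `F` in degree `m` has at least `m + a` factors `V`. -/
def HasFactors (V : R) (a : ℕ) (F : R[X]) : Prop :=
  ∀ m, F.coeff m ∈ factorSpan V (m + a)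

namespace HasFactors

variable {V : R} {a b : ℕ} {F G : R[X]}

theorem mul (hF : HasFactors V a F) (hG : HasFactors V b G) : HasFactors V (a + b) (F * G) := by
  intro m
  rw [coeff_mul]
  refine sum_mem fun x hx => ?_
  rw [← Finset.HasAntidiagonal.mem_antidiagonal.1 hx, add_add_add_comm]
  exact factorSpan.mul_mem (hF _) (hG _)

theorem C_self (V : R) : HasFactors V 1 (C V) := by
  intro m
  rw [coeff_C]
  split_ifs with h
  · subst h
    exact factorSpan.self_mem V
  · exact zero_mem _

theorem pow_line (A V : R) (n : ℕ) : HasFactors V 0 ((C A + X * C V) ^ n) := by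
  induction n with
  | zero =>
    intro m
    rw [pow_zero, coeff_one]
    split_ifs with h
    · subst h
      exact Submodule.mem_top
    · exact zero_mem _
  | succ n ih =>
    rw [pow_succ]
    refine mul (a := 0) (b := 0) ih fun m => ?_
    rw [coeff_add]
    cases m with
    | zero => exact Submodule.mem_top
    | succ m =>
      rw [coeff_C_succ, coeff_X_mul, zero_add]
      cases m with
      | zero => simpa using factorSpan.self_mem V
      | succ m => simp

end HasFactors

/-- Evaluation of a polynomial with noncommuting coefficients at a central scalar. -/
def evalScalar (z : ℂ) : R[X] →+* R :=
  eval₂RingHom' (RingHom.id R) (algebraMap ℂ R z) fun a => (Algebra.commutes z a).symm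

theorem evalScalar_C (z : ℂ) (B : R) : evalScalar z (C B) = B := by
  simp [evalScalar, eval₂RingHom']

theorem evalScalar_line (z : ℂ) (A V : R) : evalScalar z (C A + X * C V) = A + z • V := by
  rw [map_add, map_mul, evalScalar_C, evalScalar_C]
  simp [evalScalar, eval₂RingHom', Algebra.smul_def]

theorem evalScalar_eq_sum (z : ℂ) {F : R[X]} {n : ℕ} (hF : F.natDegree < n) :
    evalScalar z F = ∑ m ∈ Finset.range n, z ^ m • F.coeff m := by
  refine (eval₂_eq_sum_range' (RingHom.id R) hF (algebraMap ℂ R z)).trans ?_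
  refine Finset.sum_congr rfl fun m _ => ?_
  rw [← map_pow, ← Algebra.commutes, Algebra.smul_def, RingHom.id_apply]

end Filtration

section LineTrace

variable {A V : H →L[ℂ] H}

theorem coeff_one_pow_line (A V : H →L[ℂ] H) (r : ℕ) :
    ((C A + X * C V) ^ r).coeff 1 = D1pow A V r := by
  have h := congrArg (fun F => F.coeff 0) (derivative_pow_line A V r)
  simp only [coeff_derivative, finsetSum_coeff, mul_coeff_zero, coeff_zero_pow_line,
    coeff_C_zero] at h
  simpa [D1pow] using h

theorem coeff_two_pow_line (A V : H →L[ℂ] H) (r : ℕ) :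
    ((C A + X * C V) ^ r).coeff 2 = (1 / 2 : ℂ) • D2pow A V V r := by
  have h : ((C A + X * C V) ^ r).coeff 2 * 2 =
      (derivative (derivative ((C A + X * C V) ^ r))).coeff 0 := by
    simp only [coeff_derivative]
    simp [one_add_one_eq_two]
  simp only [derivative_pow_line, derivative_sum, derivative_mul, derivative_C, mul_zero, add_zero,
    finsetSum_coeff, coeff_add, mul_coeff_zero, coeff_zero_pow_line, coeff_C_zero,
    Finset.sum_add_distrib] at h
  have h1 : ∑ j ∈ Finset.range r, (∑ k ∈ Finset.range (r - 1 - j),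
      A ^ (r - 1 - j - 1 - k) * V * A ^ k) * V * A ^ j =
      ∑ j ∈ Finset.range (r - 1), ∑ k ∈ Finset.range (r - 1 - j),
        A ^ (r - 2 - j - k) * V * A ^ k * V * A ^ j := by
    cases r with
    | zero => simp
    | succ r =>
      rw [Finset.sum_range_succ]
      simp only [Nat.add_sub_cancel, Nat.sub_self, Finset.range_zero, Finset.sum_empty, zero_mul,
        add_zero, Finset.sum_mul]
      refine Finset.sum_congr rfl fun j _ => Finset.sum_congr rfl fun k _ => ?_
      rw [show r + 1 - 2 - j - k = r - j - 1 - k by omega]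
  have h2 : ∑ j ∈ Finset.range r, A ^ (r - 1 - j) * V * (∑ k ∈ Finset.range j,
      A ^ (j - 1 - k) * V * A ^ k) =
      ∑ j ∈ Finset.Icc 1 (r - 1), ∑ k ∈ Finset.range j,
        A ^ (r - 1 - j) * V * A ^ k * V * A ^ (j - 1 - k) := by
    symm
    refine Finset.sum_subset_zero_on_sdiff (fun j hj => ?_) (fun j hj => ?_) fun j _ => ?_
    · simp only [Finset.mem_Icc, Finset.mem_range] at hj ⊢
      omega
    · simp only [Finset.mem_sdiff, Finset.mem_Icc, Finset.mem_range] at hj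
      rw [show j = 0 by omega]
      simp
    · rw [← Finset.sum_range_reflect, Finset.mul_sum]
      refine Finset.sum_congr rfl fun k hk => ?_
      rw [Finset.mem_range] at hk
      rw [show j - 1 - (j - 1 - k) = k by omega]
      simp only [mul_assoc]
  rw [D2pow, ← h1, ← h2, ← h, mul_two, ← two_smul ℂ, smul_smul]
  norm_num

theorem IsDiagonal.isNuclear_of_mem {ι : Type} {b : HilbertBasis ι ℂ H} {l : ι → ℝ}
    (hV : IsDiagonal b V l) (hl : Summable fun i => |l i| ^ 3) {Y : H →L[ℂ] H}
    (hY : Y ∈ factorSpan V 3) : IsNuclear Y := by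
  have closed : ∀ {m : ℕ} {B : H →L[ℂ] H}, (∀ Z ∈ factorSpan V m, ∀ D, IsNuclear (Z * V * D * B)) →
      ∀ Z ∈ factorSpan V (m + 1), IsNuclear (Z * B) := fun h Z hZ => by
    refine factorSpan.induction (Q := fun Z => IsNuclear (Z * _)) h ?_ ?_ ?_ hZ
    · rw [zero_mul]
      exact IsNuclear.zero
    · intro X _ Y _ h1 h2
      rw [add_mul]
      exact h1.add h2
    · intro c X _ h
      rw [smul_mul_assoc]
      exact h.smul c
  rw [← mul_one Y]
  refine closed (fun Z hZ D₃ => ?_) Y hY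
  rw [mul_assoc, mul_assoc]
  refine closed (fun Z hZ D₂ => ?_) Z hZ
  rw [mul_assoc, mul_assoc]
  refine closed (fun Z hZ D₁ => ?_) Z hZ
  have h := ((hV.isNuclear_mul_mul hl D₁ D₂).mul_left Z).mul_right (D₃ * 1)
  simpa only [mul_assoc] using h

theorem IsDiagonal.traceAlong_mul_comm_of_mem {ι : Type} {b : HilbertBasis ι ℂ H} {l : ι → ℝ}
    (hV : IsDiagonal b V l) (hl : Summable fun i => |l i| ^ 3) (e : HilbertBasis ℕ ℂ H)
    {i j : ℕ} (hij : 3 ≤ i + j) {Y Z : H →L[ℂ] H} (hY : Y ∈ factorSpan V i)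
    (hZ : Z ∈ factorSpan V j) : traceAlong e (Y * Z) = traceAlong e (Z * Y) := by
  have nuc : ∀ {m : ℕ} {W : H →L[ℂ] H}, 3 ≤ m → W ∈ factorSpan V m → IsNuclear W :=
    fun h hW => hV.isNuclear_of_mem hl (factorSpan.antitone h hW)
  induction i generalizing j Y Z with
  | zero => exact (nuc (by omega) hZ).traceAlong_mul_comm e Y
  | succ i ih =>
    refine factorSpan.induction (Q := fun Y => traceAlong e (Y * Z) = traceAlong e (Z * Y))
      (fun Y hY B => ?_) (by simp) ?_ ?_ hY
    · have hVBZ : V * (B * Z) ∈ factorSpan V (1 + j) :=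
        factorSpan.mul_mem (factorSpan.self_mem V) (factorSpan.mul_mem_left B hZ)
      have hZYV : Z * Y * V ∈ factorSpan V (j + i + 1) :=
        factorSpan.mul_mem (factorSpan.mul_mem hZ hY) (factorSpan.self_mem V)
      calc traceAlong e (Y * V * B * Z) = traceAlong e (Y * (V * (B * Z))) := by
            simp only [mul_assoc]
        _ = traceAlong e (V * (B * Z) * Y) := ih (by omega) hY hVBZ
        _ = traceAlong e (V * (B * Z * Y)) := by simp only [mul_assoc]
        _ = traceAlong e (B * Z * Y * V) := by
            refine hV.traceAlong_mul_comm e (nuc (m := 1 + (j + i)) (by omega) ?_)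
              (nuc (m := j + i + 1) (by omega) ?_)
            · exact factorSpan.mul_mem (factorSpan.self_mem V)
                (factorSpan.mul_mem (factorSpan.mul_mem_left B hZ) hY)
            · simpa only [mul_assoc] using factorSpan.mul_mem_left B hZYV
        _ = traceAlong e (B * (Z * Y * V)) := by simp only [mul_assoc]
        _ = traceAlong e (Z * Y * V * B) := (nuc (by omega) hZYV).traceAlong_mul_comm e B
        _ = traceAlong e (Z * (Y * V * B)) := by simp only [mul_assoc]
    · intro Y hY W hW h1 h2
      have n1 := nuc (m := i + 1 + j) (by omega) (factorSpan.mul_mem hY hZ)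
      have n2 := nuc (m := i + 1 + j) (by omega) (factorSpan.mul_mem hW hZ)
      have n3 := nuc (m := j + (i + 1)) (by omega) (factorSpan.mul_mem hZ hY)
      have n4 := nuc (m := j + (i + 1)) (by omega) (factorSpan.mul_mem hZ hW)
      rw [add_mul, mul_add, traceAlong_add e n1 n2, traceAlong_add e n3 n4, h1, h2]
    · intro c Y _ h
      rw [smul_mul_assoc, mul_smul_comm, traceAlong_smul, traceAlong_smul, h]

theorem IsDiagonal.traceAlong_coeff_mul_comm {ι : Type} {b : HilbertBasis ι ℂ H} {l : ι → ℝ}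
    (hV : IsDiagonal b V l) (hl : Summable fun i => |l i| ^ 3) (e : HilbertBasis ℕ ℂ H)
    {i j m : ℕ} (hm : 3 ≤ m + (i + j)) {F G : (H →L[ℂ] H)[X]} (hF : HasFactors V i F)
    (hG : HasFactors V j G) :
    traceAlong e ((F * G).coeff m) = traceAlong e ((G * F).coeff m) := by
  have nuc : ∀ {m : ℕ} {W : H →L[ℂ] H}, 3 ≤ m → W ∈ factorSpan V m → IsNuclear W :=
    fun h hW => hV.isNuclear_of_mem hl (factorSpan.antitone h hW)
  rw [coeff_mul, coeff_mul, ← Finset.Nat.sum_antidiagonal_swap]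
  simp only [Prod.fst_swap, Prod.snd_swap]
  rw [traceAlong_sum, traceAlong_sum]
  · refine Finset.sum_congr rfl fun x hx => ?_
    have hx := Finset.HasAntidiagonal.mem_antidiagonal.1 hx
    exact hV.traceAlong_mul_comm_of_mem hl e (by omega) (hF _) (hG _)
  · intro x hx
    have hx := Finset.HasAntidiagonal.mem_antidiagonal.1 hx
    exact nuc (by omega) (factorSpan.mul_mem (hG _) (hF _))
  · intro x hx
    have hx := Finset.HasAntidiagonal.mem_antidiagonal.1 hx
    exact nuc (by omega) (factorSpan.mul_mem (hF _) (hG _))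

/-- The coefficients of `(A + zV)^r` and of its second derivative along the line have proportional
traces, by cyclicity. -/
theorem IsDiagonal.traceAlong_coeff_pow_line {ι : Type} {b : HilbertBasis ι ℂ H} {l : ι → ℝ}
    (hV : IsDiagonal b V l) (hl : Summable fun i => |l i| ^ 3) (e : HilbertBasis ℕ ℂ H)
    (A : H →L[ℂ] H) (r m : ℕ) :
    ((m + 3) * (m + 2) : ℂ) * traceAlong e (((C A + X * C V) ^ r).coeff (m + 3)) =
      r * ∑ k ∈ Finset.range (r - 1), traceAlong e ((C V * (C A + X * C V) ^ (r - 2 - k) *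
        C V * (C A + X * C V) ^ k).coeff (m + 1)) := by
  have nuc : ∀ {m : ℕ} {W : H →L[ℂ] H}, 3 ≤ m → W ∈ factorSpan V m → IsNuclear W :=
    fun h hW => hV.isNuclear_of_mem hl (factorSpan.antitone h hW)
  have hP := HasFactors.pow_line A V
  have hC := HasFactors.C_self V
  have h1 := congrArg (fun F => traceAlong e (F.coeff (m + 2))) (derivative_pow_line A V r)
  have h2 := congrArg (fun F => traceAlong e ((C V * F).coeff (m + 1)))
    (derivative_pow_line A V (r - 1))
  have h3 : C V * derivative ((C A + X * C V) ^ (r - 1)) =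
      derivative (C V * (C A + X * C V) ^ (r - 1)) := by simp
  have natmul : ∀ (n : ℕ) (T : H →L[ℂ] H), T * ((n : H →L[ℂ] H) + 1) = ((n : ℂ) + 1) • T := by
    intro n T
    rw [add_smul, one_smul, mul_add, mul_one, Nat.cast_smul_eq_nsmul, nsmul_eq_mul,
      (Nat.cast_commute n T).eq]
  simp only [h3, coeff_derivative, natmul, traceAlong_smul, finsetSum_coeff, Finset.mul_sum] at h1 h2
  rw [traceAlong_sum] at h1 h2
  rotate_left
  · intro k _
    exact nuc (by omega) (((hC.mul ((hP _).mul hC |>.mul (hP _)))) (m + 1))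
  · intro k _
    exact nuc (by omega) ((((hP _).mul hC |>.mul (hP _))) (m + 2))
  have h4 : ∀ k ∈ Finset.range r, traceAlong e (((C A + X * C V) ^ (r - 1 - k) * C V *
      (C A + X * C V) ^ k).coeff (m + 2)) =
      traceAlong e ((C V * (C A + X * C V) ^ (r - 1)).coeff (m + 2)) := fun k hk => by
    rw [Finset.mem_range] at hk
    rw [mul_assoc, hV.traceAlong_coeff_mul_comm hl e (by omega) (hP _) (hC.mul (hP _)), mul_assoc,
      ← pow_add, show k + (r - 1 - k) = r - 1 by omega]
  rw [Finset.sum_congr rfl h4, Finset.sum_const, Finset.card_range, nsmul_eq_mul] at h1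
  push_cast at h1 h2
  simp only [← mul_assoc, show r - 1 - 1 = r - 2 by omega] at h2
  rw [← h2]
  linear_combination (m + 2 : ℂ) * h1

end LineTrace

theorem integral_ofReal_pow (n : ℕ) (s : ℝ) :
    ∫ t in (0 : ℝ)..s, (t : ℂ) ^ n = (s : ℂ) ^ (n + 1) / (n + 1) := by
  simp_rw [← Complex.ofReal_pow]
  rw [intervalIntegral.integral_ofReal, integral_pow]
  simp

theorem integral_integral_sum_pow (c : ℕ → ℂ) (n : ℕ) :
    ∫ s in (0 : ℝ)..1, ∫ t in (0 : ℝ)..s, ∑ m ∈ Finset.range n, (t : ℂ) ^ (m + 1) * c m =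
      ∑ m ∈ Finset.range n, c m / ((m + 3) * (m + 2)) := by
  have h1 : ∀ s : ℝ, ∫ t in (0 : ℝ)..s, ∑ m ∈ Finset.range n, (t : ℂ) ^ (m + 1) * c m =
      ∑ m ∈ Finset.range n, (s : ℂ) ^ (m + 2) * (c m / (m + 2)) := fun s => by
    rw [intervalIntegral.integral_finsetSum fun m _ =>
      Continuous.intervalIntegrable (by fun_prop) _ _]
    refine Finset.sum_congr rfl fun m _ => ?_
    rw [intervalIntegral.integral_mul_const, integral_ofReal_pow]
    push_cast
    ring
  simp_rw [h1]
  rw [intervalIntegral.integral_finsetSum fun m _ =>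
    Continuous.intervalIntegrable (by fun_prop) _ _]
  refine Finset.sum_congr rfl fun m _ => ?_
  rw [intervalIntegral.integral_mul_const, integral_ofReal_pow]
  have h2 : (m + 2 : ℂ) ≠ 0 := by exact_mod_cast Nat.succ_ne_zero (m + 1)
  have h3 : (m + 3 : ℂ) ≠ 0 := by exact_mod_cast Nat.succ_ne_zero (m + 2)
  have h4 : ((m + 2 : ℕ) + 1 : ℂ) = m + 3 := by push_cast; ring
  rw [h4, Complex.ofReal_one, one_pow]
  field_simp

section Remainder

variable {A V : H →L[ℂ] H}

theorem pow_sub_taylor_eq_sum (A V : H →L[ℂ] H) (r : ℕ) :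
    (A + V) ^ r - A ^ r - D1pow A V r - (1 / 2 : ℝ) • D2pow A V V r =
      ∑ m ∈ Finset.range r, ((C A + X * C V) ^ r).coeff (m + 3) := by
  have h := evalScalar_eq_sum 1 (F := (C A + X * C V) ^ r) (n := r + 3)
    ((natDegree_pow_line_le A V r).trans_lt (by omega))
  rw [map_pow, evalScalar_line, one_smul, Finset.sum_range_succ', Finset.sum_range_succ',
    Finset.sum_range_succ'] at h
  simp only [one_pow, one_smul, zero_add, Nat.reduceAdd, coeff_zero_pow_line, coeff_one_pow_line,
    coeff_two_pow_line, add_assoc] at h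
  have h2 : (1 / 2 : ℝ) • D2pow A V V r = (1 / 2 : ℂ) • D2pow A V V r := by
    rw [← Complex.coe_smul]
    norm_num
  rw [h, h2]
  abel

theorem IsDiagonal.traceAlong_line_sub {ι : Type} {b : HilbertBasis ι ℂ H} {l : ι → ℝ}
    (hV : IsDiagonal b V l) (hl : Summable fun i => |l i| ^ 3) (e : HilbertBasis ℕ ℂ H)
    (A : H →L[ℂ] H) (t : ℝ) {p q n : ℕ} (hn : p + q ≤ n) :
    traceAlong e (V * (A + t • V) ^ p * V * (A + t • V) ^ q - V * A ^ p * V * A ^ q) =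
      ∑ m ∈ Finset.range n, (t : ℂ) ^ (m + 1) * traceAlong e ((C V * (C A + X * C V) ^ p *
        C V * (C A + X * C V) ^ q).coeff (m + 1)) := by
  set F := C V * (C A + X * C V) ^ p * C V * (C A + X * C V) ^ q with hF
  have hP := HasFactors.pow_line A V
  have hC := HasFactors.C_self V
  have hdeg : F.natDegree < n + 1 := by
    have h1 := natDegree_mul_le_of_le (natDegree_mul_le_of_le (natDegree_mul_le_of_le
      (natDegree_C V).le (natDegree_pow_line_le A V p)) (natDegree_C V).le)
      (natDegree_pow_line_le A V q)
    rw [← hF] at h1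
    omega
  have h := evalScalar_eq_sum t hdeg
  rw [Finset.sum_range_succ', pow_zero, one_smul] at h
  have h0 : F.coeff 0 = V * A ^ p * V * A ^ q := by
    simp only [hF, mul_coeff_zero, coeff_zero_pow_line, coeff_C_zero]
  simp only [hF, map_mul, map_pow, evalScalar_C, evalScalar_line] at h
  rw [← hF, h0, Complex.coe_smul] at h
  rw [h, add_sub_cancel_right, traceAlong_sum]
  · simp only [traceAlong_smul]
  · intro m _
    refine IsNuclear.smul (hV.isNuclear_of_mem hl (factorSpan.antitone ?_
      ((((hC.mul (hP p)).mul hC).mul (hP q)) (m + 1)))) _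
    omega

end Remainder

end Polynomials

/-- **Lemma 2.2.** For bounded self-adjoint `A` and self-adjoint `V ∈ B₃(H)` on a separable
infinite-dimensional Hilbert space, with `A_τ = A + τV`,
`(A+V)^r − A^r − D¹(A^r)(V) − ½D²(A^r)(V,V)` is trace class and
`Tr[(A+V)^r − A^r − D¹(A^r)(V) − ½D²(A^r)(V,V)]
  = r ∑_{k=0}^{r-2} ∫₀¹ ds ∫₀ˢ dτ Tr[V A_τ^{r-k-2} V A_τ^k − V A^{r-k-2} V A^k]`. -/
theorem trace_formula_pow_schatten3
    (e : HilbertBasis ℕ ℂ H)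
    (A V : H →L[ℂ] H) (hA : IsSelfAdjoint A) (hV : IsSelfAdjoint V)
    (hV3 : IsSchatten3 e V) (r : ℕ) :
    IsTraceClass e
      ((A + V) ^ r - A ^ r - D1pow A V r - (1 / 2 : ℝ) • D2pow A V V r) ∧
    traceAlong e
      ((A + V) ^ r - A ^ r - D1pow A V r - (1 / 2 : ℝ) • D2pow A V V r)
      = (r : ℂ) * ∑ k ∈ Finset.range (r - 1),
          ∫ s in (0:ℝ)..1, ∫ τ in (0:ℝ)..s,
            traceAlong e
              (V * (A + τ • V) ^ (r - 2 - k) * V * (A + τ • V) ^ k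
                - V * A ^ (r - 2 - k) * V * A ^ k) := by
  obtain ⟨ι, b, l, hD, hl⟩ := hV3.exists_isDiagonal hV
  have nuc : ∀ m ∈ Finset.range r, IsNuclear
      (((Polynomial.C A + Polynomial.X * Polynomial.C V) ^ r).coeff (m + 3)) := fun m _ =>
    hD.isNuclear_of_mem hl (factorSpan.antitone (by omega) (HasFactors.pow_line A V r (m + 3)))
  rw [pow_sub_taylor_eq_sum]
  refine ⟨(IsNuclear.sum _ nuc).isTraceClass e, ?_⟩
  have hint : ∀ k ∈ Finset.range (r - 1), _ := fun k hk =>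
    (intervalIntegral.integral_congr fun s _ => intervalIntegral.integral_congr fun t _ =>
      hD.traceAlong_line_sub hl e A t (p := r - 2 - k) (q := k) (n := r) (by
        rw [Finset.mem_range] at hk
        omega)).trans (integral_integral_sum_pow _ r)
  rw [Finset.sum_congr rfl hint, Finset.sum_comm, traceAlong_sum e _ nuc, Finset.mul_sum]
  refine Finset.sum_congr rfl fun m _ => ?_
  have h2 : (m + 2 : ℂ) ≠ 0 := by exact_mod_cast Nat.succ_ne_zero (m + 1)
  have h3 : (m + 3 : ℂ) ≠ 0 := by exact_mod_cast Nat.succ_ne_zero (m + 2)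
  rw [← Finset.sum_div, ← mul_div_assoc, ← hD.traceAlong_coeff_pow_line hl e A r m]
  field_simp
end
end

section
/- Let A be a (possibly unbounded) self-adjoint operator on a separable infinite-dimensional complex Hilbert space H and set B = (A+i)^{-1}. Then the commutator operator M_B(X) = BX − XB is a bounded normal operator on the Hilbert space B_2(H) of Hilbert–Schmidt operators, and for every self-adjoint X ∈ B_2(H), writing X = X₁ ⊕ X₂ for its orthogonal decomposition relative to B_2(H) = Ker(M_B) ⊕ closure(Ran(M_{B*})), both X₁ and X₂ are self-adjoint. -/
open MeasureTheory
noncomputable section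

local notation "⟪" x ", " y "⟫" => @inner ℂ _ _ x y

variable {H : Type} [NormedAddCommGroup H] [InnerProductSpace ℂ H] [CompleteSpace H]

/-- `T` is a Hilbert–Schmidt operator (`∑ ‖T e_n‖² < ∞` along a Hilbert basis). -/
def IsHS (e : HilbertBasis ℕ ℂ H) (T : H →L[ℂ] H) : Prop :=
  Summable fun n => ‖T (e n)‖ ^ 2

/-- The squared Hilbert–Schmidt norm `‖T‖₂²`. -/
def hsNormSq (e : HilbertBasis ℕ ℂ H) (T : H →L[ℂ] H) : ℝ :=
  ∑' n, ‖T (e n)‖ ^ 2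

/-- The Hilbert–Schmidt norm `‖T‖₂`. -/
def hsNorm (e : HilbertBasis ℕ ℂ H) (T : H →L[ℂ] H) : ℝ :=
  Real.sqrt (hsNormSq e T)

/-- The Hilbert–Schmidt inner product `⟨X,Y⟩₂ = Tr(X^*Y) = ∑ ⟨X e_n, Y e_n⟩`. -/
def hsInner (e : HilbertBasis ℕ ℂ H) (X Y : H →L[ℂ] H) : ℂ :=
  ∑' n, ⟪X (e n), Y (e n)⟫

/-- `X ∈ Ker(M_B)`, i.e. `X` is Hilbert–Schmidt and `BX = XB`. -/
def InKerM (e : HilbertBasis ℕ ℂ H) (B X : H →L[ℂ] H) : Prop :=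
  IsHS e X ∧ B * X = X * B

/-- `X` lies in the closure (in Hilbert–Schmidt norm) of `Ran(M_B) = {BY − YB : Y ∈ B₂(H)}`. -/
def InClosRanM (e : HilbertBasis ℕ ℂ H) (B X : H →L[ℂ] H) : Prop :=
  IsHS e X ∧ ∀ ε > 0, ∃ Y : H →L[ℂ] H, IsHS e Y ∧ hsNorm e (B * Y - Y * B - X) < ε

namespace IsHS

variable {e : HilbertBasis ℕ ℂ H} {X Y T : H →L[ℂ] H}

/-- The sequence `(T e_n)` of a Hilbert–Schmidt operator `T`, as an element of `ℓ²(ℕ, H)`. -/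
def toLp (hT : IsHS e T) : lp (fun _ : ℕ => H) 2 :=
  ⟨fun n => T (e n), memℓp_gen (by simpa [IsHS] using hT)⟩

omit [CompleteSpace H] in
@[simp]
theorem toLp_apply (hT : IsHS e T) (n : ℕ) : hT.toLp n = T (e n) := rfl

omit [CompleteSpace H] in
theorem of_eq_toLp (f : lp (fun _ : ℕ => H) 2) (h : ∀ n, f n = T (e n)) : IsHS e T := by
  have := (lp.memℓp f).summable (by norm_num)
  simpa [IsHS, h] using this

omit [CompleteSpace H] in
theorem hsNorm_eq (hT : IsHS e T) : hsNorm e T = ‖hT.toLp‖ := by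
  rw [lp.norm_eq_tsum_rpow (by norm_num)]
  simp [hsNorm, hsNormSq, Real.sqrt_eq_rpow]

omit [CompleteSpace H] in
theorem hsInner_eq (hX : IsHS e X) (hY : IsHS e Y) :
    hsInner e X Y = ⟪hX.toLp, hY.toLp⟫ := by
  rw [lp.inner_eq_tsum]
  rfl

omit [CompleteSpace H] in
theorem sub (hX : IsHS e X) (hY : IsHS e Y) : IsHS e (X - Y) :=
  of_eq_toLp (hX.toLp - hY.toLp) fun _ => rfl

omit [CompleteSpace H] in
theorem neg (hX : IsHS e X) : IsHS e (-X) :=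
  of_eq_toLp (-hX.toLp) fun _ => rfl

omit [CompleteSpace H] in
theorem toLp_sub (hX : IsHS e X) (hY : IsHS e Y) (h : IsHS e (X - Y)) :
    h.toLp = hX.toLp - hY.toLp := rfl

omit [CompleteSpace H] in
theorem toLp_neg (hX : IsHS e X) (h : IsHS e (-X)) : h.toLp = -hX.toLp := rfl

omit [CompleteSpace H] in
theorem eq_zero_of_toLp (hT : IsHS e T) (h : hT.toLp = 0) : T = 0 := by
  refine ContinuousLinearMap.ext_on
    (Submodule.dense_iff_topologicalClosure_eq_top.mpr e.dense_span) ?_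
  rintro _ ⟨n, rfl⟩
  simpa using congrArg (fun f : lp (fun _ : ℕ => H) 2 => f n) h

end IsHS

omit [CompleteSpace H] in
theorem HilbertBasis.hasSum_norm_inner_sq (e : HilbertBasis ℕ ℂ H) (x : H) :
    HasSum (fun m => ‖⟪e m, x⟫‖ ^ 2) (‖x‖ ^ 2) := by
  have h := lp.hasSum_norm (p := 2) (by norm_num) (e.repr x)
  simpa [e.repr_apply_apply] using h

omit [CompleteSpace H] in
theorem isHS_iff_summable_matrix {e : HilbertBasis ℕ ℂ H} {T : H →L[ℂ] H} :
    IsHS e T ↔ Summable fun p : ℕ × ℕ => ‖⟪e p.2, T (e p.1)⟫‖ ^ 2 := by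
  rw [summable_prod_of_nonneg fun _ => by positivity]
  simp only [(e.hasSum_norm_inner_sq _).tsum_eq]
  exact ⟨fun h => ⟨fun n => (e.hasSum_norm_inner_sq _).summable, h⟩, fun h => h.2⟩

namespace IsHS

variable {e : HilbertBasis ℕ ℂ H} {X Y T : H →L[ℂ] H}

theorem star (hT : IsHS e T) : IsHS e (star T) := by
  rw [isHS_iff_summable_matrix] at hT ⊢
  refine hT.prod_symm.congr fun p => ?_
  rw [ContinuousLinearMap.star_eq_adjoint, ContinuousLinearMap.adjoint_inner_right,
    norm_inner_symm]
  rfl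

theorem hsInner_star (hX : IsHS e X) (hY : IsHS e Y) :
    hsInner e (Star.star Y) (Star.star X) = hsInner e X Y := by
  have hs : Summable (Function.uncurry fun n m : ℕ =>
      ⟪X (e n), e m⟫ * ⟪e m, Y (e n)⟫) := by
    refine .of_norm_bounded
      ((isHS_iff_summable_matrix.mp hX).add (isHS_iff_summable_matrix.mp hY)) fun p => ?_
    simp only [Function.uncurry, norm_mul]
    rw [norm_inner_symm]
    nlinarith [two_mul_le_add_sq ‖⟪e p.2, X (e p.1)⟫‖ ‖⟪e p.2, Y (e p.1)⟫‖,
      sq_nonneg ‖⟪e p.2, X (e p.1)⟫‖, sq_nonneg ‖⟪e p.2, Y (e p.1)⟫‖]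
  calc hsInner e (Star.star Y) (Star.star X)
      = ∑' m, ∑' n, ⟪X (e n), e m⟫ * ⟪e m, Y (e n)⟫ := by
        refine tsum_congr fun m => ?_
        rw [← e.tsum_inner_mul_inner]
        refine tsum_congr fun n => ?_
        simp only [ContinuousLinearMap.star_eq_adjoint, ContinuousLinearMap.adjoint_inner_right,
          ContinuousLinearMap.adjoint_inner_left]
        ring
    _ = ∑' n, ∑' m, ⟪X (e n), e m⟫ * ⟪e m, Y (e n)⟫ := hs.tsum_comm
    _ = hsInner e X Y := tsum_congr fun n => e.tsum_inner_mul_inner _ _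

theorem hsNorm_star (hT : IsHS e T) : hsNorm e (Star.star T) = hsNorm e T := by
  have h := hT.hsInner_star hT
  rw [hsInner_eq hT.star hT.star, hsInner_eq hT hT, inner_self_eq_norm_sq_to_K,
    inner_self_eq_norm_sq_to_K, ← hsNorm_eq, ← hsNorm_eq] at h
  exact (sq_eq_sq₀ (Real.sqrt_nonneg _) (Real.sqrt_nonneg _)).mp (by exact_mod_cast h)

omit [CompleteSpace H] in
theorem norm_mul_apply_sq_le (B T : H →L[ℂ] H) (x : H) :
    ‖(B * T) x‖ ^ 2 ≤ ‖B‖ ^ 2 * ‖T x‖ ^ 2 := by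
  rw [← mul_pow]
  gcongr
  exact B.le_opNorm _

omit [CompleteSpace H] in
theorem mul_left (hT : IsHS e T) (B : H →L[ℂ] H) : IsHS e (B * T) :=
  .of_nonneg_of_le (fun _ => by positivity) (fun n => norm_mul_apply_sq_le B T (e n))
    (Summable.mul_left _ hT)

theorem mul_right (hT : IsHS e T) (B : H →L[ℂ] H) : IsHS e (T * B) := by
  simpa using (hT.star.mul_left (Star.star B)).star

theorem commutator (hT : IsHS e T) (B : H →L[ℂ] H) : IsHS e (B * T - T * B) :=
  (hT.mul_left B).sub (hT.mul_right B)

omit [CompleteSpace H] in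
theorem hsNorm_mul_left_le (hT : IsHS e T) (B : H →L[ℂ] H) :
    hsNorm e (B * T) ≤ ‖B‖ * hsNorm e T := by
  refine Real.sqrt_le_iff.mpr ⟨mul_nonneg (norm_nonneg _) (Real.sqrt_nonneg _), ?_⟩
  rw [hsNorm, hsNormSq, hsNormSq, mul_pow, Real.sq_sqrt (tsum_nonneg fun _ => by positivity),
    ← tsum_mul_left]
  exact Summable.tsum_le_tsum (fun n => norm_mul_apply_sq_le B T (e n)) (hT.mul_left B)
    (Summable.mul_left _ hT)

theorem hsNorm_mul_right_le (hT : IsHS e T) (B : H →L[ℂ] H) :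
    hsNorm e (T * B) ≤ ‖B‖ * hsNorm e T := by
  have h := hT.star.hsNorm_mul_left_le (Star.star B)
  rwa [← star_mul, (hT.mul_right B).hsNorm_star, hT.hsNorm_star, norm_star] at h

omit [CompleteSpace H] in
theorem hsNorm_sub_le (hX : IsHS e X) (hY : IsHS e Y) :
    hsNorm e (X - Y) ≤ hsNorm e X + hsNorm e Y := by
  rw [hsNorm_eq hX, hsNorm_eq hY, hsNorm_eq (hX.sub hY)]
  exact norm_sub_le hX.toLp hY.toLp

theorem hsNorm_commutator_le (hT : IsHS e T) (B : H →L[ℂ] H) :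
    hsNorm e (B * T - T * B) ≤ 2 * ‖B‖ * hsNorm e T := by
  linarith [hsNorm_sub_le (hT.mul_left B) (hT.mul_right B), hT.hsNorm_mul_left_le B,
    hT.hsNorm_mul_right_le B]

theorem hsInner_mul_left (B : H →L[ℂ] H) :
    hsInner e (B * X) Y = hsInner e X (Star.star B * Y) :=
  tsum_congr fun _ => (ContinuousLinearMap.adjoint_inner_right B _ _).symm

theorem hsInner_mul_right (hX : IsHS e X) (hY : IsHS e Y) (B : H →L[ℂ] H) :
    hsInner e (X * B) Y = hsInner e X (Y * Star.star B) := by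
  rw [← (hX.mul_right B).hsInner_star hY, ← hX.hsInner_star (hY.mul_right _), star_mul, star_mul,
    star_star, hsInner_mul_left]

omit [CompleteSpace H] in
theorem hsInner_sub_left (hX : IsHS e X) (hY : IsHS e Y) (hT : IsHS e T) :
    hsInner e (X - Y) T = hsInner e X T - hsInner e Y T := by
  rw [hsInner_eq (hX.sub hY) hT, hsInner_eq hX hT, hsInner_eq hY hT, toLp_sub hX hY, inner_sub_left]

omit [CompleteSpace H] in
theorem hsInner_sub_right (hT : IsHS e T) (hX : IsHS e X) (hY : IsHS e Y) :
    hsInner e T (X - Y) = hsInner e T X - hsInner e T Y := by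
  rw [hsInner_eq hT (hX.sub hY), hsInner_eq hT hX, hsInner_eq hT hY, toLp_sub hX hY,
    inner_sub_right]

theorem hsInner_commutator (hX : IsHS e X) (hY : IsHS e Y) (B : H →L[ℂ] H) :
    hsInner e (B * X - X * B) Y = hsInner e X (Star.star B * Y - Y * Star.star B) := by
  rw [hsInner_sub_left (hX.mul_left B) (hX.mul_right B) hY,
    hsInner_sub_right hX (hY.mul_left _) (hY.mul_right _), hsInner_mul_left,
    hsInner_mul_right hX hY]

omit [CompleteSpace H] in
theorem norm_hsInner_le (hX : IsHS e X) (hY : IsHS e Y) :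
    ‖hsInner e X Y‖ ≤ hsNorm e X * hsNorm e Y := by
  rw [hsInner_eq hX hY, hsNorm_eq hX, hsNorm_eq hY]
  exact norm_inner_le_norm _ _

omit [CompleteSpace H] in
theorem eq_zero_of_hsInner_self (hT : IsHS e T) (h : hsInner e T T = 0) : T = 0 := by
  rw [hsInner_eq hT hT, inner_self_eq_zero] at h
  exact hT.eq_zero_of_toLp h

end IsHS

/-- `Ker(M_B)` is orthogonal to the closure of `Ran(M_{B^*})`. -/
theorem InKerM.hsInner_eq_zero {e : HilbertBasis ℕ ℂ H} {B X Y : H →L[ℂ] H}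
    (hX : InKerM e B X) (hY : InClosRanM e (star B) Y) : hsInner e X Y = 0 := by
  have hX0 : 0 ≤ hsNorm e X := Real.sqrt_nonneg _
  refine norm_le_zero_iff.mp (le_of_forall_pos_le_add fun ε hε => ?_)
  obtain ⟨Z, hZ, hlt⟩ := hY.2 (ε / (hsNorm e X + 1)) (by positivity)
  have hR := hZ.commutator (star B)
  have h0 : hsInner e X (star B * Z - Z * star B) = 0 := by
    rw [← hX.1.hsInner_commutator hZ, hX.2, sub_self]
    simp [hsInner]
  have h1 := hX.1.norm_hsInner_le (hR.sub hY.1)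
  rw [IsHS.hsInner_sub_right hX.1 hR hY.1, h0, zero_sub, norm_neg] at h1
  rw [lt_div_iff₀ (by positivity)] at hlt
  have h2 : 0 ≤ hsNorm e (star B * Z - Z * star B - Y) := Real.sqrt_nonneg _
  linarith

section Resolvent

variable {A : H →ₗ.[ℂ] H} {B : H →L[ℂ] H}

theorem apply_star_resolvent (hA : IsSelfAdjoint A)
    (hB : ∀ y : A.domain, B (A y + Complex.I • (y : H)) = (y : H)) (x : H) :
    ∃ h : star B x ∈ A.domain, A ⟨star B x, h⟩ = x + Complex.I • star B x := by
  have key : ∀ y : A.domain, ⟪x + Complex.I • star B x, (y : H)⟫ = ⟪star B x, A y⟫ := by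
    intro y
    have h1 : B (A y) = y - Complex.I • B y := by
      rw [eq_sub_iff_add_eq, ← map_smul, ← map_add, hB]
    rw [inner_add_left, inner_smul_left, ContinuousLinearMap.star_eq_adjoint,
      ContinuousLinearMap.adjoint_inner_left, ContinuousLinearMap.adjoint_inner_left, h1,
      inner_sub_right, inner_smul_right, Complex.conj_I]
    ring
  have hA' := LinearPMap.isSelfAdjoint_def.mp hA
  have hmem : star B x ∈ A.adjoint.domain :=
    LinearPMap.mem_adjoint_domain_of_exists _ ⟨_, key⟩
  have happ := LinearPMap.adjoint_apply_eq hA.dense_domain ⟨_, hmem⟩ key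
  clear key
  revert hmem
  rw [hA']
  exact fun hmem happ => ⟨hmem, happ⟩

theorem resolvent_mul_star (hA : IsSelfAdjoint A)
    (hB : ∀ y : A.domain, B (A y + Complex.I • (y : H)) = (y : H)) :
    (2 * Complex.I) • (B * star B) = star B - B := by
  ext x
  obtain ⟨h, hx⟩ := apply_star_resolvent hA hB x
  have h1 := hB ⟨_, h⟩
  rw [hx] at h1
  simp only [map_add, map_smul] at h1
  change (2 * Complex.I) • B (star B x) = star B x - B x
  rw [eq_sub_iff_add_eq, mul_smul, two_smul]
  nth_rw 3 [← h1]
  abel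

theorem star_resolvent_mul (hA : IsSelfAdjoint A)
    (hB₁ : ∀ x : H, ∃ h : B x ∈ A.domain, A ⟨B x, h⟩ + Complex.I • B x = x) :
    (2 * Complex.I) • (star B * B) = star B - B := by
  have hleft : ∀ y : A.domain, star B (A y - Complex.I • (y : H)) = y := by
    intro y
    refine ext_inner_right ℂ fun x => ?_
    obtain ⟨h, hx⟩ := hB₁ x
    have hsymm : ⟪A y, B x⟫ = ⟪(y : H), A ⟨B x, h⟩⟫ := by
      have := LinearPMap.adjoint_isFormalAdjoint hA.dense_domain
      rw [LinearPMap.isSelfAdjoint_def.mp hA] at this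
      exact this y ⟨B x, h⟩
    rw [ContinuousLinearMap.star_eq_adjoint, ContinuousLinearMap.adjoint_inner_left,
      inner_sub_left, inner_smul_left, hsymm]
    nth_rw 3 [← hx]
    rw [inner_add_right, inner_smul_right, Complex.conj_I]
    ring
  ext x
  obtain ⟨h, hx⟩ := hB₁ x
  have h1 := hleft ⟨_, h⟩
  rw [eq_sub_of_add_eq hx] at h1
  simp only [map_sub, map_smul] at h1
  change (2 * Complex.I) • star B (B x) = star B x - B x
  rw [mul_smul, two_smul]
  nth_rw 3 [← h1]
  abel

/-- The relations `2i BB^* = 2i B^*B = B^* - B` say that the Cayley transform `1 - 2iB` is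
invertible with inverse `1 + 2iB^*`, so the commutant of `B` is contained in that of `B^*`. -/
theorem commute_star_of_commute {X : H →L[ℂ] H}
    (h₁ : (2 * Complex.I) • (B * star B) = star B - B)
    (h₂ : (2 * Complex.I) • (star B * B) = star B - B) (h : B * X = X * B) :
    star B * X = X * star B := by
  set S := star B
  set c : ℂ := 2 * Complex.I
  have hinv : (1 - c • B) * (1 + c • S) = 1 := by
    have : (1 - c • B) * (1 + c • S) = 1 + c • S - c • B - c • (c • (B * S)) := by
      simp only [sub_mul, mul_add, one_mul, mul_one, smul_mul_assoc, mul_smul_comm, smul_sub]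
      abel
    rw [this, h₁, smul_sub]
    abel
  have hS : S * (1 - c • B) = B := by
    rw [mul_sub, mul_one, mul_smul_comm, h₂]
    abel
  have hX : X * (1 - c • B) = (1 - c • B) * X := by
    simp [mul_sub, sub_mul, h]
  calc S * X = S * (X * (1 - c • B)) * (1 + c • S) := by
        rw [mul_assoc, mul_assoc, hinv, mul_one]
    _ = B * X * (1 + c • S) := by rw [hX, ← mul_assoc, hS]
    _ = X * (S * (1 - c • B)) * (1 + c • S) := by rw [h, hS]
    _ = X * S := by rw [mul_assoc, mul_assoc, hinv, mul_one]

end Resolvent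

/-- **Lemma 2.3 (vi)(b).** Let `A` be a (possibly unbounded) self-adjoint operator on a
separable infinite-dimensional complex Hilbert space and let `B = (A+i)⁻¹` be its bounded
resolvent at `−i`.  Then `M_B` is a bounded normal operator on `B₂(H)` (its adjoint is
`M_{B^*}` and it commutes with `M_{B^*}`), and for every self-adjoint `X ∈ B₂(H)` the
components in `X = X₁ ⊕ X₂ ∈ Ker(M_B) ⊕ closure(Ran(M_{B^*}))` are both self-adjoint. -/
theorem commutator_resolvent_normal_on_HS_and_decomposition
    (e : HilbertBasis ℕ ℂ H)
    (A : H →ₗ.[ℂ] H) (hA : IsSelfAdjoint A)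
    (B : H →L[ℂ] H)
    (hB₁ : ∀ x : H, ∃ h : B x ∈ A.domain, A ⟨B x, h⟩ + Complex.I • B x = x)
    (hB₂ : ∀ y : A.domain, B (A y + Complex.I • (y : H)) = (y : H)) :
    (∀ X : H →L[ℂ] H, IsHS e X → IsHS e (B * X - X * B)) ∧
    (∃ C : ℝ, 0 ≤ C ∧ ∀ X : H →L[ℂ] H, IsHS e X →
        hsNorm e (B * X - X * B) ≤ C * hsNorm e X) ∧
    (∀ X Y : H →L[ℂ] H, IsHS e X → IsHS e Y →
        hsInner e (B * X - X * B) Y = hsInner e X (star B * Y - Y * star B)) ∧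
    (∀ X : H →L[ℂ] H, IsHS e X →
        star B * (B * X - X * B) - (B * X - X * B) * star B
          = B * (star B * X - X * star B) - (star B * X - X * star B) * B) ∧
    (∀ X X₁ X₂ : H →L[ℂ] H, IsSelfAdjoint X →
        InKerM e B X₁ → InClosRanM e (star B) X₂ → X = X₁ + X₂ →
        IsSelfAdjoint X₁ ∧ IsSelfAdjoint X₂) := by
  have h₁ := resolvent_mul_star hA hB₂
  have h₂ := star_resolvent_mul hA hB₁
  have hcomm : B * star B = star B * B :=
    smul_right_injective _ (mul_ne_zero two_ne_zero Complex.I_ne_zero) (h₁.trans h₂.symm)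
  refine ⟨fun X hX => hX.commutator B,
    ⟨2 * ‖B‖, by positivity, fun X hX => hX.hsNorm_commutator_le B⟩,
    fun X Y hX hY => hX.hsInner_commutator hY B, fun X _ => ?_, ?_⟩
  · have ha : B * (star B * X) = star B * (B * X) := by rw [← mul_assoc, hcomm, mul_assoc]
    have hb : X * star B * B = X * B * star B := by rw [mul_assoc, ← hcomm, mul_assoc]
    simp only [mul_sub, sub_mul, ha, hb, ← mul_assoc]
    abel
  · intro X X₁ X₂ hX hX₁ hX₂ hadd
    have hD : X₁ - star X₁ = star X₂ - X₂ := by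
      have h := hX.star_eq
      rw [hadd, star_add] at h
      rw [sub_eq_sub_iff_add_eq_add, ← h]
      abel
    have hker : InKerM e B (X₁ - star X₁) := by
      refine ⟨hX₁.1.sub hX₁.1.star, ?_⟩
      have h := congrArg star (commute_star_of_commute h₁ h₂ hX₁.2)
      simp only [star_mul, star_star] at h
      rw [mul_sub, sub_mul, hX₁.2, h]
    have horth := hker.hsInner_eq_zero hX₂
    have horth' : hsInner e (X₁ - star X₁) (star X₂) = 0 := by
      have hneg : star (X₁ - star X₁) = -(X₁ - star X₁) := by simp
      rw [← hker.1.hsInner_star hX₂.1.star, star_star, hneg,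
        IsHS.hsInner_eq hX₂.1 hker.1.neg, hker.1.toLp_neg, inner_neg_right,
        ← inner_conj_symm, ← IsHS.hsInner_eq hker.1 hX₂.1, horth]
      simp
    have hzero : X₁ - star X₁ = 0 := by
      refine hker.1.eq_zero_of_hsInner_self ?_
      nth_rw 2 [hD]
      rw [IsHS.hsInner_sub_right hker.1 hX₂.1.star hX₂.1, horth, horth', sub_zero]
    exact ⟨(sub_eq_zero.mp hzero).symm, sub_eq_zero.mp (hD.symm.trans hzero)⟩
end
end
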